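/- arXiv:1906.04022 — 3 statements merged into one kernel-verified Lean document; each statement's English description precedes it below -/
import Mathlib

section
/- The trust-region subproblem (T) possesses a KKT point (x, μ) with wᵀ₁q ≠ 0, μ ∈ (−λ₂, −λ₁) and s′(μ) > 0 (i.e., a second-order sufficient local-nonglobal minimizer) if and only if (T) is not in the hard case and the second-rightmost eigenvalue of M (when the 2n eigenvalues of M, counted with algebraic multiplicity, are ordered by decreasing real part) is real, simple, and not an eigenvalue of −P. Furthermore, when such a minimizer exists, its Lagrange multiplier μ is equal to this second-rightmost eigenvalue of M. -/
open Matrix Complex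
open scoped Classical

noncomputable section

/-- Euclidean norm of a vector in `ℝⁿ`. -/
def euclNorm {n : ℕ} (x : Fin n → ℝ) : ℝ := Real.sqrt (x ⬝ᵥ x)

/-- The quadratic objective `f(x) = ½ xᵀPx + qᵀx`. -/
def qobj {n : ℕ} (P : Matrix (Fin n) (Fin n) ℝ) (q : Fin n → ℝ) (x : Fin n → ℝ) : ℝ :=
  (1 / 2) * (x ⬝ᵥ P.mulVec x) + q ⬝ᵥ x

/-- The block matrix `M = [[-P, qqᵀ/r²], [I, -P]]`. -/
def trsM {n : ℕ} (P : Matrix (Fin n) (Fin n) ℝ) (q : Fin n → ℝ) (r : ℝ) :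
    Matrix (Fin n ⊕ Fin n) (Fin n ⊕ Fin n) ℝ :=
  Matrix.fromBlocks (-P) ((r ^ 2)⁻¹ • Matrix.vecMulVec q q) 1 (-P)

/-- The complexification of `M`. -/
def trsMC {n : ℕ} (P : Matrix (Fin n) (Fin n) ℝ) (q : Fin n → ℝ) (r : ℝ) :
    Matrix (Fin n ⊕ Fin n) (Fin n ⊕ Fin n) ℂ :=
  (trsM P q r).map Complex.ofReal

/-- `μ ∈ ℂ` is an eigenvalue of the complex matrix `A`. -/
def IsEig {m : Type*} [Fintype m] (A : Matrix m m ℂ) (μ : ℂ) : Prop :=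
  ∃ v : m → ℂ, v ≠ 0 ∧ A.mulVec v = μ • v

/-- The secular function `s(z) = Σᵢ (wᵢᵀq)²/(λᵢ + z)² - r²` on `ℂ`. -/
def secular {n : ℕ} (lam : Fin n → ℝ) (w : Fin n → Fin n → ℝ) (q : Fin n → ℝ) (r : ℝ)
    (z : ℂ) : ℂ :=
  (∑ i, ((w i ⬝ᵥ q : ℝ) : ℂ) ^ 2 / (((lam i : ℝ) : ℂ) + z) ^ 2) - (r : ℂ) ^ 2

/-- The secular function on `ℝ`. -/
def secularR {n : ℕ} (lam : Fin n → ℝ) (w : Fin n → Fin n → ℝ) (q : Fin n → ℝ) (r : ℝ)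
    (t : ℝ) : ℝ :=
  (∑ i, (w i ⬝ᵥ q) ^ 2 / (lam i + t) ^ 2) - r ^ 2

/-- The derivative of the secular function, `s'(t) = -2 Σᵢ (wᵢᵀq)²/(λᵢ + t)³`. -/
def secularDeriv {n : ℕ} (lam : Fin n → ℝ) (w : Fin n → Fin n → ℝ) (q : Fin n → ℝ)
    (t : ℝ) : ℝ :=
  -2 * ∑ i, (w i ⬝ᵥ q) ^ 2 / (lam i + t) ^ 3

/-- `z` is not a pole of the secular function (the poles are the `-λᵢ` with `wᵢᵀq ≠ 0`). -/
def IsNonpole {n : ℕ} (lam : Fin n → ℝ) (w : Fin n → Fin n → ℝ) (q : Fin n → ℝ) (z : ℂ) : Prop :=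
  ∀ i, w i ⬝ᵥ q ≠ 0 → z ≠ -((lam i : ℝ) : ℂ)

/-- `f` has a zero of order exactly `k` at `z`. -/
def HasZeroOfOrder (f : ℂ → ℂ) (z : ℂ) (k : ℕ) : Prop :=
  ∃ g : ℂ → ℂ, AnalyticAt ℂ g z ∧ g z ≠ 0 ∧ ∀ᶠ u in nhds z, f u = (u - z) ^ k * g u

end

/-- Problem (T) is in the hard case: the Lagrange multiplier of some global minimizer
equals `-λ₁` (here `lam1 = λ₁`). -/
def HardCase {n : ℕ} (P : Matrix (Fin n) (Fin n) ℝ) (q : Fin n → ℝ) (r : ℝ)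
    (lam1 : ℝ) : Prop :=
  ∃ (x : Fin n → ℝ) (μ : ℝ),
    P.mulVec x + q + μ • x = 0 ∧ euclNorm x = r ∧
    (∀ y : Fin n → ℝ, euclNorm y = r → qobj P q x ≤ qobj P q y) ∧
    μ = -lam1

/-- `μ` is a second-rightmost eigenvalue of `M`, when the `2n` eigenvalues of `M`
(the roots of its characteristic polynomial, counted with algebraic multiplicity)
are ordered by decreasing real part. -/
def SecondRightmost {n : ℕ} (P : Matrix (Fin n) (Fin n) ℝ) (q : Fin n → ℝ) (r : ℝ)
    (μ : ℂ) : Prop :=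
  ∃ μ₁ ∈ (trsMC P q r).charpoly.roots,
    (∀ z ∈ (trsMC P q r).charpoly.roots, z.re ≤ μ₁.re) ∧
    μ ∈ ((trsMC P q r).charpoly.roots).erase μ₁ ∧
    ∀ z ∈ ((trsMC P q r).charpoly.roots).erase μ₁, z.re ≤ μ.re

/-! ### The characteristic polynomial of `M` -/

/-- The polynomial `∏ᵢ (X + λᵢ)² - r⁻² ∑ᵢ cᵢ² ∏_{j ≠ i} (X + λⱼ)²`. -/
noncomputable def secularPoly {n : ℕ} (lam c : Fin n → ℝ) (r : ℝ) : Polynomial ℝ :=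
  ∏ i, (Polynomial.X + Polynomial.C (lam i)) ^ 2 -
    Polynomial.C (r ^ 2)⁻¹ * ∑ i, Polynomial.C (c i ^ 2) *
      ∏ j ∈ Finset.univ.erase i, (Polynomial.X + Polynomial.C (lam j)) ^ 2

theorem aeval_secularPoly {K : Type*} [Field K] [Algebra ℝ K] {n : ℕ} (lam c : Fin n → ℝ) (r : ℝ)
    {z : K} (hz : ∀ i, algebraMap ℝ K (lam i) + z ≠ 0) :
    Polynomial.aeval z (secularPoly lam c r) =
      (∏ i, (algebraMap ℝ K (lam i) + z) ^ 2) *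
        (1 - algebraMap ℝ K (r ^ 2)⁻¹ *
          ∑ i, algebraMap ℝ K (c i ^ 2) / (algebraMap ℝ K (lam i) + z) ^ 2) := by
  have key : ∀ i, (∏ j ∈ Finset.univ.erase i, (algebraMap ℝ K (lam j) + z) ^ 2) =
      (∏ j, (algebraMap ℝ K (lam j) + z) ^ 2) / (algebraMap ℝ K (lam i) + z) ^ 2 := fun i => by
    rw [eq_div_iff (pow_ne_zero 2 (hz i)), Finset.prod_erase_mul _ _ (Finset.mem_univ i)]
  simp only [secularPoly, map_sub, map_mul, map_sum, map_prod, map_pow, map_add,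
    Polynomial.aeval_X, Polynomial.aeval_C, add_comm z, key]
  rw [mul_sub, mul_one, Finset.mul_sum, Finset.mul_sum, Finset.mul_sum]
  congr 1
  exact Finset.sum_congr rfl fun i _ => by ring

theorem eval_secularPoly {n : ℕ} (lam c : Fin n → ℝ) (r : ℝ) {t : ℝ} (ht : ∀ i, lam i + t ≠ 0) :
    (secularPoly lam c r).eval t =
      (∏ i, (lam i + t) ^ 2) * (1 - (r ^ 2)⁻¹ * ∑ i, c i ^ 2 / (lam i + t) ^ 2) := by
  simpa using aeval_secularPoly lam c r (K := ℝ) (z := t) ht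

theorem eval_map_secularPoly {n : ℕ} (lam c : Fin n → ℝ) (r : ℝ) {z : ℂ}
    (hz : ∀ i, (lam i : ℂ) + z ≠ 0) :
    ((secularPoly lam c r).map Complex.ofRealHom).eval z =
      (∏ i, ((lam i : ℂ) + z) ^ 2) *
        (1 - ((r : ℂ) ^ 2)⁻¹ * ∑ i, (c i : ℂ) ^ 2 / ((lam i : ℂ) + z) ^ 2) := by
  rw [show Complex.ofRealHom = algebraMap ℝ ℂ from rfl, Polynomial.eval_map_algebraMap,
    aeval_secularPoly lam c r hz]
  simp

/-- The value at `-λₖ` keeps only the `k`-th summand. -/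
theorem eval_secularPoly_neg {n : ℕ} (lam c : Fin n → ℝ) (r : ℝ) (k : Fin n) :
    (secularPoly lam c r).eval (-lam k) =
      -((r ^ 2)⁻¹ * (c k ^ 2 * ∏ j ∈ Finset.univ.erase k, (-lam k + lam j) ^ 2)) := by
  simp only [secularPoly, Polynomial.eval_sub, Polynomial.eval_mul, Polynomial.eval_finsetSum,
    Polynomial.eval_prod, Polynomial.eval_pow, Polynomial.eval_add, Polynomial.eval_X,
    Polynomial.eval_C]
  rw [Finset.prod_eq_zero (Finset.mem_univ k) (by simp), Finset.sum_eq_single k, zero_sub]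
  · intro i _ hik
    rw [Finset.prod_eq_zero (i := k) (by simp [hik.symm]) (by simp), mul_zero]
  · simp

theorem sq_dvd_secularPoly {n : ℕ} (lam c : Fin n → ℝ) (r : ℝ) (k : Fin n)
    (h : c k = 0 ∨ ∃ j, j ≠ k ∧ lam j = lam k) :
    (Polynomial.X + Polynomial.C (lam k)) ^ 2 ∣ secularPoly lam c r := by
  refine dvd_sub (Finset.dvd_prod_of_mem (fun i => (Polynomial.X + Polynomial.C (lam i)) ^ 2)
    (Finset.mem_univ k)) (Dvd.dvd.mul_left (Finset.dvd_sum fun i _ => ?_) _)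
  by_cases hik : i = k
  · subst hik
    rcases h with h | ⟨j, hj, hjk⟩
    · simp [h]
    · rw [← hjk]
      exact (Finset.dvd_prod_of_mem (fun i => (Polynomial.X + Polynomial.C (lam i)) ^ 2)
        (by simp [hj])).mul_left _
  · exact (Finset.dvd_prod_of_mem (fun i => (Polynomial.X + Polynomial.C (lam i)) ^ 2)
        (by simp [Ne.symm hik])).mul_left _

theorem det_fromBlocks_diagonal_vecMulVec {n : ℕ} (d c : Fin n → ℝ) (hd : ∀ i, d i ≠ 0) (s : ℝ) :
    (Matrix.fromBlocks (diagonal d) (-(s • vecMulVec c c)) (-1) (diagonal d)).det =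
      (∏ i, d i ^ 2) * (1 - s * ∑ i, c i ^ 2 / d i ^ 2) := by
  have hdet : IsUnit (diagonal d).det := by
    rw [det_diagonal, isUnit_iff_ne_zero]
    exact Finset.prod_ne_zero_iff.2 fun i _ => hd i
  have hinv : (diagonal d)⁻¹ = diagonal (fun i => (d i)⁻¹) := by
    refine inv_eq_right_inv ?_
    rw [diagonal_mul_diagonal, ← diagonal_one]
    exact congrArg diagonal (funext fun i => mul_inv_cancel₀ (hd i))
  let _ := invertibleOfIsUnitDet _ hdet
  rw [det_fromBlocks₂₂, invOf_eq_nonsing_inv, hinv]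
  have hB : diagonal d - -(s • vecMulVec c c) * diagonal (fun i => (d i)⁻¹) * -1 =
      diagonal d + replicateCol Unit (-s • c) * replicateRow Unit (fun i => c i / d i) := by
    ext i j
    simp [Matrix.mul_apply, vecMulVec_apply, diagonal_apply, div_eq_mul_inv]
    ring
  have hdot : (1 + replicateRow Unit (fun i => c i / d i) * diagonal (fun i => (d i)⁻¹) *
      replicateCol Unit (-s • c) : Matrix Unit Unit ℝ).det = 1 - s * ∑ i, c i ^ 2 / d i ^ 2 := by
    rw [det_unique]
    rw [Matrix.add_apply, Matrix.one_apply_eq, Matrix.mul_apply]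
    simp only [Matrix.mul_diagonal, replicateRow_apply, replicateCol_apply, Pi.smul_apply, smul_eq_mul, Finset.mul_sum]
    rw [sub_eq_add_neg, ← Finset.sum_neg_distrib]
    congr 1
    exact Finset.sum_congr rfl fun i _ => by ring
  rw [hB, det_add_replicateCol_mul_replicateRow hdet, hinv, hdot, det_diagonal, Finset.prod_pow]
  ring

theorem charpoly_trsM {n : ℕ} (P : Matrix (Fin n) (Fin n) ℝ) (lam : Fin n → ℝ)
    (w : Fin n → Fin n → ℝ) (heig : ∀ i, P.mulVec (w i) = lam i • w i)
    (horth : ∀ i j, w i ⬝ᵥ w j = if i = j then (1 : ℝ) else 0) (hP : P.IsSymm)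
    (q : Fin n → ℝ) (r : ℝ) :
    (trsM P q r).charpoly = secularPoly lam (fun i => w i ⬝ᵥ q) r := by
  set W : Matrix (Fin n) (Fin n) ℝ := Matrix.of w with hW
  set c : Fin n → ℝ := fun i => w i ⬝ᵥ q with hc
  have hWW : W * Wᵀ = 1 := by
    ext i j
    rw [Matrix.mul_apply', Matrix.one_apply]
    exact horth i j
  have hWW' : Wᵀ * W = 1 := mul_eq_one_comm.1 hWW
  have hWP : W * P = diagonal lam * W := by
    ext i j
    rw [diagonal_mul]
    have := congrFun (heig i) j
    rw [← hP.eq, mulVec_transpose] at this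
    exact this
  have hcW : W *ᵥ q = c := rfl
  have hcW' : c ᵥ* W = q := by
    rw [← hcW, ← mulVec_transpose, mulVec_mulVec, hWW', one_mulVec]
  have hfin : Set.Finite (Set.range fun i => -lam i) := Set.finite_range _
  refine Polynomial.eq_of_infinite_eval_eq _ _ (hfin.infinite_compl.mono fun t ht => ?_)
  have hd : ∀ i, lam i + t ≠ 0 := fun i h => ht ⟨i, by simp only []; linarith⟩
  change Polynomial.eval t _ = Polynomial.eval t _
  rw [eval_secularPoly _ _ _ hd, eval_charpoly,
    ← det_fromBlocks_diagonal_vecMulVec (fun i => lam i + t) c hd]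
  have hU : fromBlocks W 0 0 W * fromBlocks Wᵀ 0 0 Wᵀ = 1 := by
    simp [fromBlocks_multiply, hWW]
  have hUdet : (fromBlocks W 0 0 W).det ≠ 0 := fun h => by
    have := congrArg det hU
    rw [det_mul, h, zero_mul, det_one] at this
    exact zero_ne_one this
  have hsim : fromBlocks W 0 0 W * (Matrix.scalar (Fin n ⊕ Fin n) t - trsM P q r) =
      fromBlocks (diagonal fun i => lam i + t) (-((r ^ 2)⁻¹ • vecMulVec c c)) (-1)
        (diagonal fun i => lam i + t) * fromBlocks W 0 0 W := by
    have hscal : Matrix.scalar (Fin n ⊕ Fin n) t = fromBlocks (t • 1) 0 0 (t • 1) := by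
      rw [← smul_zero t, ← fromBlocks_smul, fromBlocks_one, Matrix.scalar_apply, smul_one_eq_diagonal]
    have hdiag : (diagonal fun i => lam i + t) = diagonal lam + t • (1 : Matrix (Fin n) (Fin n) ℝ) := by
      rw [smul_one_eq_diagonal, diagonal_add]
    have h1 : vecMulVec c c * W = vecMulVec c q := by rw [vecMulVec_mul, hcW']
    have h2 : W * vecMulVec q q = vecMulVec c q := by rw [mul_vecMulVec, hcW]
    rw [hscal, trsM, sub_eq_add_neg, fromBlocks_neg, fromBlocks_add, fromBlocks_multiply,
      fromBlocks_multiply, hdiag]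
    simp [Matrix.mul_add, Matrix.add_mul, hWP, h1, h2, add_comm]
  have := congrArg det hsim
  rw [det_mul, det_mul, mul_comm] at this
  exact mul_right_cancel₀ hUdet this

theorem charpoly_trsMC {n : ℕ} (P : Matrix (Fin n) (Fin n) ℝ) (q : Fin n → ℝ) (r : ℝ) :
    (trsMC P q r).charpoly = (trsM P q r).charpoly.map Complex.ofRealHom :=
  Matrix.charpoly_map _ Complex.ofRealHom

/-! ### Zeros of the secular function -/

theorem ofReal_add_ne_zero {l : ℝ} {z : ℂ} (h : l + z.re ≠ 0 ∨ z.im ≠ 0) : (l : ℂ) + z ≠ 0 :=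
  fun h0 => by
    have hre := congrArg Complex.re h0
    have him := congrArg Complex.im h0
    simp only [add_re, ofReal_re, zero_re, add_im, ofReal_im, zero_add, zero_im] at hre him
    exact h.elim (· hre) (· him)

theorem im_divided_difference {e d b : ℝ} (he : e ≠ 0) (hb : b ≠ 0) :
    (((e + d : ℝ) + b * I) / ((e : ℂ) ^ 2 * ((d : ℂ) + b * I) ^ 2)).im =
      -b * ((d ^ 2 + b ^ 2 + 2 * (e * d)) / (e ^ 2 * (d ^ 2 + b ^ 2) ^ 2)) := by
  have hdb : d ^ 2 + b ^ 2 ≠ 0 := by positivity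
  have hz : (d : ℂ) + b * I ≠ 0 := fun h => hb (by simpa using congrArg Complex.im h)
  have hw : (d : ℂ) - b * I ≠ 0 := fun h => hb (by simpa using congrArg Complex.im h)
  have hprod : ((d : ℂ) + b * I) * (d - b * I) = ((d ^ 2 + b ^ 2 : ℝ) : ℂ) := by
    push_cast
    linear_combination (-(b : ℂ) ^ 2) * I_sq
  have : ((e + d : ℝ) + b * I) / ((e : ℂ) ^ 2 * ((d : ℂ) + b * I) ^ 2) =
      ((e + d : ℝ) + b * I) * (d - b * I) ^ 2 / ((e ^ 2 * (d ^ 2 + b ^ 2) ^ 2 : ℝ) : ℂ) := by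
    rw [ofReal_mul, ofReal_pow, ofReal_pow, ← hprod]
    have he' : (e : ℂ) ≠ 0 := ofReal_ne_zero.2 he
    field_simp
  rw [this, div_ofReal_im]
  rw [mul_div_assoc']
  congr 1
  simp [pow_two]
  ring

/-- A nonreal `z` and a real `μ` on the same side of every `-λᵢ` are not on the same level. -/
theorem secular_sum_ne_of_im_ne_zero {n : ℕ} {lam c : Fin n → ℝ} {μ : ℝ} {z : ℂ}
    (hμ : ∀ i, lam i + μ ≠ 0) (hz : z.im ≠ 0)
    (hsign : ∀ i, 0 ≤ (lam i + μ) * (lam i + z.re)) {k : Fin n} (hk : c k ≠ 0) :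
    ∑ i, (c i : ℂ) ^ 2 / ((lam i : ℂ) + z) ^ 2 ≠ ((∑ i, c i ^ 2 / (lam i + μ) ^ 2 : ℝ) : ℂ) := by
  intro h
  have hzμ : z - μ ≠ 0 := fun h0 => hz (by simpa using congrArg Complex.im h0)
  have hsplit : ∀ i, (lam i : ℂ) + z = ((lam i + z.re : ℝ) : ℂ) + z.im * I := fun i => by
    push_cast
    rw [add_assoc, re_add_im]
  have hzero : ∑ i, (c i : ℂ) ^ 2 * ((((lam i + μ) + (lam i + z.re) : ℝ) + z.im * I) /
      (((lam i + μ : ℝ) : ℂ) ^ 2 * (((lam i + z.re : ℝ) : ℂ) + z.im * I) ^ 2)) = 0 := by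
    refine (mul_eq_zero.1 (?_ : -(z - μ) * _ = 0)).resolve_left (neg_ne_zero.2 hzμ)
    rw [← sub_eq_zero.2 h, ofReal_sum, ← Finset.sum_sub_distrib, Finset.mul_sum]
    refine Finset.sum_congr rfl fun i _ => ?_
    have h1 : (lam i : ℂ) + z ≠ 0 := ofReal_add_ne_zero (Or.inr hz)
    have h2 : (lam i : ℂ) + μ ≠ 0 := by exact_mod_cast hμ i
    have h3 : (((lam i + μ) + (lam i + z.re) : ℝ) : ℂ) + z.im * I = (lam i + μ) + (lam i + z) := by
      rw [hsplit]
      push_cast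
      ring
    rw [h3, ← hsplit]
    push_cast
    field_simp
    ring
  have him := congrArg Complex.im hzero
  rw [im_sum] at him
  have hterm : ∀ i, ((c i : ℂ) ^ 2 * ((((lam i + μ) + (lam i + z.re) : ℝ) + z.im * I) /
      (((lam i + μ : ℝ) : ℂ) ^ 2 * (((lam i + z.re : ℝ) : ℂ) + z.im * I) ^ 2))).im =
      -z.im * (c i ^ 2 * (((lam i + z.re) ^ 2 + z.im ^ 2 + 2 * ((lam i + μ) * (lam i + z.re))) /
        ((lam i + μ) ^ 2 * ((lam i + z.re) ^ 2 + z.im ^ 2) ^ 2))) := fun i => by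
    rw [← ofReal_pow, im_ofReal_mul, im_divided_difference (hμ i) hz]
    ring
  simp only [hterm, zero_im] at him
  rw [← Finset.mul_sum] at him
  have hsum := (mul_eq_zero.1 him).resolve_left (neg_ne_zero.2 hz)
  have hpos : ∀ i, 0 < ((lam i + z.re) ^ 2 + z.im ^ 2 + 2 * ((lam i + μ) * (lam i + z.re))) /
        ((lam i + μ) ^ 2 * ((lam i + z.re) ^ 2 + z.im ^ 2) ^ 2) := fun i => by
    have := hsign i
    have := hμ i
    positivity
  refine absurd hsum (ne_of_gt (Finset.sum_pos' (fun i _ => ?_) ⟨k, Finset.mem_univ k, ?_⟩))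
  · exact mul_nonneg (sq_nonneg _) (hpos i).le
  · exact mul_pos (by positivity) (hpos k)

theorem norm_secular_sum_lt {n : ℕ} {lam c : Fin n → ℝ} {z : ℂ}
    (hm : ∀ i, lam i + z.re ≠ 0) (hz : z.im ≠ 0) {k : Fin n} (hk : c k ≠ 0) :
    ‖∑ i, (c i : ℂ) ^ 2 / ((lam i : ℂ) + z) ^ 2‖ < ∑ i, c i ^ 2 / (lam i + z.re) ^ 2 := by
  have hnorm : ∀ i, ‖(c i : ℂ) ^ 2 / ((lam i : ℂ) + z) ^ 2‖ =
      c i ^ 2 / ((lam i + z.re) ^ 2 + z.im ^ 2) := fun i => by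
    rw [norm_div, norm_pow, norm_pow, Complex.sq_norm, Complex.sq_norm, normSq_apply, normSq_apply]
    simp [pow_two]
  refine (norm_sum_le _ _).trans_lt (Finset.sum_lt_sum (fun i _ => ?_)
    ⟨k, Finset.mem_univ k, ?_⟩) <;> rw [hnorm]
  · have := hm i
    gcongr
    nlinarith [sq_nonneg z.im]
  · have := hm k
    gcongr
    have : 0 < z.im ^ 2 := by positivity
    linarith

theorem secular_sum_strictAnti {n : ℕ} {lam c : Fin n → ℝ} {s t : ℝ} (hs : ∀ i, 0 < lam i + s)
    (hst : s < t) {k : Fin n} (hk : c k ≠ 0) :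
    ∑ i, c i ^ 2 / (lam i + t) ^ 2 < ∑ i, c i ^ 2 / (lam i + s) ^ 2 := by
  refine Finset.sum_lt_sum (fun i _ => ?_) ⟨k, Finset.mem_univ k, ?_⟩
  · have := hs i
    gcongr
  · have := hs k
    gcongr

/-- The tangent-line inequality for the secular function between two consecutive poles. -/
theorem secular_sum_tangent_le {n : ℕ} {lam c : Fin n → ℝ} {s t : ℝ}
    (h : ∀ i, 0 < (lam i + s) * (lam i + t)) :
    ∑ i, c i ^ 2 / (lam i + s) ^ 2 + (t - s) * (-2 * ∑ i, c i ^ 2 / (lam i + s) ^ 3) ≤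
      ∑ i, c i ^ 2 / (lam i + t) ^ 2 := by
  rw [Finset.mul_sum, Finset.mul_sum, ← Finset.sum_add_distrib]
  refine Finset.sum_le_sum fun i _ => ?_
  have hi := h i
  have hs : lam i + s ≠ 0 := left_ne_zero_of_mul hi.ne'
  have ht : lam i + t ≠ 0 := right_ne_zero_of_mul hi.ne'
  rw [← sub_nonneg]
  have hts : t - s = (lam i + t) - (lam i + s) := by ring
  rw [hts]
  generalize lam i + s = e at *
  generalize lam i + t = d at *
  have key : c i ^ 2 / d ^ 2 - (c i ^ 2 / e ^ 2 + (d - e) * (-2 * (c i ^ 2 / e ^ 3))) =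
      c i ^ 2 * (d - e) ^ 2 * (e ^ 2 + 2 * (e * d)) / (d ^ 2 * e ^ 4) := by
    field_simp
    ring
  rw [key]
  positivity

/-- To the right of every `-λᵢ` each level is attained at most once. -/
theorem eq_of_secular_sum_eq {n : ℕ} {lam c : Fin n → ℝ} {μ : ℝ} {z : ℂ}
    (hμ : ∀ i, 0 < lam i + μ) (hz : ∀ i, 0 < lam i + z.re) {k : Fin n} (hk : c k ≠ 0)
    (h : ∑ i, (c i : ℂ) ^ 2 / ((lam i : ℂ) + z) ^ 2 =
      ((∑ i, c i ^ 2 / (lam i + μ) ^ 2 : ℝ) : ℂ)) : z = μ := by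
  have him : z.im = 0 := by
    by_contra him
    exact secular_sum_ne_of_im_ne_zero (fun i => (hμ i).ne') him
      (fun i => (mul_pos (hμ i) (hz i)).le) hk h
  obtain ⟨t, rfl⟩ : ∃ t : ℝ, z = t := ⟨z.re, Complex.ext rfl him⟩
  simp only [ofReal_re] at hz
  have h' : ∑ i, c i ^ 2 / (lam i + t) ^ 2 = ∑ i, c i ^ 2 / (lam i + μ) ^ 2 := by exact_mod_cast h
  rcases lt_trichotomy t μ with hlt | heq | hgt
  · exact absurd h' (secular_sum_strictAnti hz hlt hk).ne'
  · rw [heq]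
  · exact absurd h' (secular_sum_strictAnti hμ hgt hk).ne

/-! ### Counting roots on either side of a vertical line -/

/-- A continuous choice of the argument, modulo `π`, of `∏ (m + b i - ρ)` along the line
`Re z = m`. -/
noncomputable def lineAngle (m : ℝ) (S : Multiset ℂ) (b : ℝ) : ℝ :=
  (S.map fun ρ => Real.arctan ((b - ρ.im) / (m - ρ.re))).sum

theorem exists_eq_mul_exp_arctan {x y : ℝ} (hx : x ≠ 0) :
    ∃ R : ℝ, (x : ℂ) + y * I = R * Complex.exp (Real.arctan (y / x) * I) := by
  have hcos := (Real.cos_arctan_pos (y / x)).ne'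
  have hsin : Real.sin (Real.arctan (y / x)) = y / x * Real.cos (Real.arctan (y / x)) := by
    rw [← Real.tan_mul_cos hcos, Real.tan_arctan]
  refine ⟨x / Real.cos (Real.arctan (y / x)), ?_⟩
  rw [exp_mul_I, ← ofReal_cos, ← ofReal_sin, hsin]
  have h1 : ((Real.cos (Real.arctan (y / x)) : ℝ) : ℂ) ≠ 0 := ofReal_ne_zero.2 hcos
  have h2 : (x : ℂ) ≠ 0 := ofReal_ne_zero.2 hx
  rw [ofReal_mul, ofReal_div, ofReal_div]
  field_simp

theorem exists_prod_eq_mul_exp_lineAngle {m : ℝ} (b : ℝ) {S : Multiset ℂ}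
    (hS : ∀ ρ ∈ S, ρ.re ≠ m) :
    ∃ R : ℝ, (S.map fun ρ => ((m : ℂ) + b * I - ρ)).prod =
      R * Complex.exp (lineAngle m S b * I) := by
  induction S using Multiset.induction_on with
  | empty => exact ⟨1, by simp [lineAngle]⟩
  | cons ρ S ih =>
    obtain ⟨R, hR⟩ := ih fun z hz => hS z (Multiset.mem_cons_of_mem hz)
    obtain ⟨R', hR'⟩ := exists_eq_mul_exp_arctan (y := b - ρ.im)
      (sub_ne_zero.2 (hS ρ (Multiset.mem_cons_self ρ S)).symm)
    refine ⟨R' * R, ?_⟩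
    have hρ : (m : ℂ) + b * I - ρ = ((m - ρ.re : ℝ) : ℂ) + ((b - ρ.im : ℝ) : ℂ) * I := by
      conv_lhs => rw [← re_add_im ρ]
      push_cast
      ring
    rw [Multiset.map_cons, Multiset.prod_cons, hR, hρ, hR', lineAngle, lineAngle, Multiset.map_cons,
      Multiset.sum_cons]
    push_cast
    rw [add_mul, Complex.exp_add]
    ring

theorem continuous_lineAngle (m : ℝ) (S : Multiset ℂ) : Continuous (lineAngle m S) :=
  continuous_multiset_sum S fun _ _ => by fun_prop

theorem tendsto_lineAngle_atTop {m : ℝ} {S : Multiset ℂ} (hS : ∀ ρ ∈ S, ρ.re ≠ m) :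
    Filter.Tendsto (lineAngle m S) Filter.atTop
      (nhds (Real.pi / 2 * (S.map fun ρ => Real.sign (m - ρ.re)).sum)) := by
  rw [← Multiset.sum_map_mul_left]
  refine tendsto_multiset_sum S fun ρ hρ => ?_
  have hlin : Filter.Tendsto (fun b : ℝ => b - ρ.im) Filter.atTop Filter.atTop :=
    Filter.tendsto_atTop_add_const_right _ (-ρ.im) Filter.tendsto_id
  rcases lt_or_gt_of_ne (sub_ne_zero.2 (hS ρ hρ).symm) with h | h
  · rw [Real.sign_of_neg h, mul_neg_one]
    exact (Real.tendsto_arctan_atBot.mono_right nhdsWithin_le_nhds).comp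
      (hlin.atTop_div_const_of_neg h)
  · rw [Real.sign_of_pos h, mul_one]
    exact (Real.tendsto_arctan_atTop.mono_right nhdsWithin_le_nhds).comp (hlin.atTop_div_const h)

theorem tendsto_lineAngle_atBot {m : ℝ} {S : Multiset ℂ} (hS : ∀ ρ ∈ S, ρ.re ≠ m) :
    Filter.Tendsto (lineAngle m S) Filter.atBot
      (nhds (-(Real.pi / 2 * (S.map fun ρ => Real.sign (m - ρ.re)).sum))) := by
  rw [← neg_mul, ← Multiset.sum_map_mul_left]
  refine tendsto_multiset_sum S fun ρ hρ => ?_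
  have hlin : Filter.Tendsto (fun b : ℝ => b - ρ.im) Filter.atBot Filter.atBot :=
    Filter.tendsto_atBot_add_const_right _ (-ρ.im) Filter.tendsto_id
  rcases lt_or_gt_of_ne (sub_ne_zero.2 (hS ρ hρ).symm) with h | h
  · rw [Real.sign_of_neg h, mul_neg_one, neg_neg]
    exact (Real.tendsto_arctan_atTop.mono_right nhdsWithin_le_nhds).comp
      ((Filter.tendsto_div_const_atTop_of_neg h).2 hlin)
  · rw [Real.sign_of_pos h, mul_one]
    exact (Real.tendsto_arctan_atBot.mono_right nhdsWithin_le_nhds).comp (hlin.atBot_div_const h)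

/-- If a quotient of polynomials has positive real part along the line `Re z = m` away from a
simple zero of the numerator at `m`, then it has, up to a bounded defect, as many zeros as poles
to the left of the line. Here `S` lists the other zeros, and `T` lists the (double) poles. -/
theorem sum_sign_sub_lt_three {m : ℝ} {S T : Multiset ℂ} (hS : ∀ ρ ∈ S, ρ.re ≠ m)
    (hT : ∀ ρ ∈ T, ρ.re ≠ m) {f : ℝ → ℂ} (hf : ∀ b ≠ 0, 0 < (f b).re)
    (h : ∀ b : ℝ, b ≠ 0 → (b : ℂ) * I * (S.map fun ρ => ((m : ℂ) + b * I - ρ)).prod =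
      (T.map fun ρ => ((m : ℂ) + b * I - ρ)).prod ^ 2 * f b) :
    (S.map fun ρ => Real.sign (m - ρ.re)).sum - 2 * (T.map fun ρ => Real.sign (m - ρ.re)).sum
      < 3 := by
  set D : ℝ := (S.map fun ρ => Real.sign (m - ρ.re)).sum -
    2 * (T.map fun ρ => Real.sign (m - ρ.re)).sum with hD
  set Ψ : ℝ → ℝ := fun b => lineAngle m S b - 2 * lineAngle m T b with hΨ
  have hcont : Continuous Ψ :=
    (continuous_lineAngle m S).sub (continuous_const.mul (continuous_lineAngle m T))
  have htop : Filter.Tendsto Ψ Filter.atTop (nhds (Real.pi / 2 * D)) := by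
    convert (tendsto_lineAngle_atTop hS).sub ((tendsto_lineAngle_atTop hT).const_mul 2) using 2
    rw [hD]
    ring
  have hbot : Filter.Tendsto Ψ Filter.atBot (nhds (-(Real.pi / 2 * D))) := by
    convert (tendsto_lineAngle_atBot hS).sub ((tendsto_lineAngle_atBot hT).const_mul 2) using 2
    rw [hD]
    ring
  have hsin : ∀ b ≠ 0, Real.sin (Ψ b) ≠ 0 := by
    intro b hb hsin
    obtain ⟨R, hR⟩ := exists_prod_eq_mul_exp_lineAngle b hS
    obtain ⟨R', hR'⟩ := exists_prod_eq_mul_exp_lineAngle b hT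
    have hb' := h b hb
    rw [hR, hR', mul_pow, ← Complex.exp_nat_mul] at hb'
    have hR'0 : R' ≠ 0 := by
      rintro rfl
      rw [ofReal_zero, zero_mul, Multiset.prod_eq_zero_iff, Multiset.mem_map] at hR'
      obtain ⟨ρ, hρ, h0⟩ := hR'
      refine hT ρ hρ ?_
      simpa [sub_eq_zero, eq_comm] using congrArg Complex.re h0
    have hexp : ((b * R : ℝ) : ℂ) * (I * Complex.exp (Ψ b * I)) = ((R' ^ 2 : ℝ) : ℂ) * f b := by
      have h1 : Complex.exp (lineAngle m S b * I) =
          Complex.exp (Ψ b * I) * Complex.exp ((2 : ℕ) * (lineAngle m T b * I)) := by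
        rw [← Complex.exp_add, hΨ]
        congr 1
        push_cast
        ring
      rw [h1] at hb'
      refine mul_right_cancel₀ (Complex.exp_ne_zero ((2 : ℕ) * (lineAngle m T b * I))) ?_
      push_cast at hb' ⊢
      linear_combination hb'
    have hre := congrArg Complex.re hexp
    rw [re_ofReal_mul, re_ofReal_mul, I_mul_re, exp_ofReal_mul_I_im, hsin] at hre
    have := hf b hb
    have : 0 < R' ^ 2 * (f b).re := by positivity
    linarith
  by_contra! hD3
  have hbig : Real.pi < Real.pi / 2 * D := by nlinarith [Real.pi_pos]
  have hhit : ∀ c : ℝ, |c| ≤ Real.pi → ∃ b, Ψ b = c := fun c hc => by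
    have hc' := abs_le.1 hc
    refine mem_range_of_exists_le_of_exists_ge hcont ?_ ?_
    · obtain ⟨b, hb⟩ := (hbot.eventually_lt_const (by linarith : -(Real.pi / 2 * D) < c)).exists
      exact ⟨b, hb.le⟩
    · obtain ⟨b, hb⟩ := (htop.eventually_const_lt (by linarith : c < Real.pi / 2 * D)).exists
      exact ⟨b, hb.le⟩
  obtain ⟨b₁, h₁⟩ := hhit 0 (by simpa using Real.pi_pos.le)
  obtain ⟨b₂, h₂⟩ := hhit Real.pi (abs_of_pos Real.pi_pos).le
  have h₁0 : b₁ = 0 := by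
    by_contra hb
    exact hsin b₁ hb (by rw [h₁, Real.sin_zero])
  have h₂0 : b₂ = 0 := by
    by_contra hb
    exact hsin b₂ hb (by rw [h₂, Real.sin_pi])
  rw [h₁0] at h₁
  rw [h₂0, h₁] at h₂
  exact Real.pi_pos.ne h₂

/-! ### Roots of `secularPoly` -/

theorem hasDerivAt_secular_sum {n : ℕ} {lam c : Fin n → ℝ} {t : ℝ} (ht : ∀ i, lam i + t ≠ 0) :
    HasDerivAt (fun u => ∑ i, c i ^ 2 / (lam i + u) ^ 2)
      (-2 * ∑ i, c i ^ 2 / (lam i + t) ^ 3) t := by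
  rw [Finset.mul_sum]
  refine HasDerivAt.fun_sum fun i _ => ?_
  have h := (((hasDerivAt_id t).const_add (lam i)).fun_pow 2).fun_inv (pow_ne_zero 2 (ht i))
  have h' := h.const_mul (c i ^ 2)
  simp only [id_eq, ← div_eq_mul_inv] at h'
  refine h'.congr_deriv ?_
  have := ht i
  push_cast
  field_simp

theorem eval_derivative_secularPoly {n : ℕ} {lam c : Fin n → ℝ} {r t : ℝ} (hr : r ≠ 0)
    (ht : ∀ i, lam i + t ≠ 0) (hroot : ∑ i, c i ^ 2 / (lam i + t) ^ 2 = r ^ 2) :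
    (secularPoly lam c r).derivative.eval t =
      (∏ i, (lam i + t) ^ 2) * (2 * (r ^ 2)⁻¹) * ∑ i, c i ^ 2 / (lam i + t) ^ 3 := by
  have hf : HasDerivAt (fun u => 1 - (r ^ 2)⁻¹ * ∑ i, c i ^ 2 / (lam i + u) ^ 2)
      (-((r ^ 2)⁻¹ * (-2 * ∑ i, c i ^ 2 / (lam i + t) ^ 3))) t :=
    ((hasDerivAt_secular_sum ht).const_mul _).const_sub 1
  have hD : DifferentiableAt ℝ (fun u => ∏ i, (lam i + u) ^ 2) t := by fun_prop
  have hmul := hD.hasDerivAt.mul hf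
  have hev : (fun u => (secularPoly lam c r).eval u) =ᶠ[nhds t]
      (fun u => ∏ i, (lam i + u) ^ 2) *
        fun u => 1 - (r ^ 2)⁻¹ * ∑ i, c i ^ 2 / (lam i + u) ^ 2 := by
    have : ∀ᶠ u in nhds t, ∀ i, lam i + u ≠ 0 := Filter.eventually_all.2 fun i =>
      ContinuousAt.eventually_ne (by fun_prop) (ht i)
    filter_upwards [this] with u hu
    exact eval_secularPoly lam c r hu
  rw [((secularPoly lam c r).hasDerivAt t).unique (hmul.congr_of_eventuallyEq hev), hroot,
    inv_mul_cancel₀ (pow_ne_zero 2 hr)]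
  ring

theorem eval_secularPoly_eq_zero_iff {n : ℕ} {lam c : Fin n → ℝ} {r t : ℝ} (hr : r ≠ 0)
    (ht : ∀ i, lam i + t ≠ 0) :
    (secularPoly lam c r).eval t = 0 ↔ ∑ i, c i ^ 2 / (lam i + t) ^ 2 = r ^ 2 := by
  have hD : ∏ i, (lam i + t) ^ 2 ≠ 0 := Finset.prod_ne_zero_iff.2 fun i _ => pow_ne_zero 2 (ht i)
  rw [eval_secularPoly lam c r ht, mul_eq_zero, or_iff_right hD, sub_eq_zero, eq_comm,
    inv_mul_eq_iff_eq_mul₀ (pow_ne_zero 2 hr), mul_one]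

theorem eval_map_secularPoly_eq_zero_iff {n : ℕ} {lam c : Fin n → ℝ} {r : ℝ} (hr : r ≠ 0) {z : ℂ}
    (hz : ∀ i, (lam i : ℂ) + z ≠ 0) :
    ((secularPoly lam c r).map Complex.ofRealHom).eval z = 0 ↔
      ∑ i, (c i : ℂ) ^ 2 / ((lam i : ℂ) + z) ^ 2 = ((r ^ 2 : ℝ) : ℂ) := by
  have hD : ∏ i, ((lam i : ℂ) + z) ^ 2 ≠ 0 :=
    Finset.prod_ne_zero_iff.2 fun i _ => pow_ne_zero 2 (hz i)
  rw [eval_map_secularPoly lam c r hz, mul_eq_zero, or_iff_right hD, sub_eq_zero, eq_comm,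
    inv_mul_eq_iff_eq_mul₀ (pow_ne_zero 2 (ofReal_ne_zero.2 hr)), mul_one, ofReal_pow]

theorem ofReal_mem_roots_map {p : Polynomial ℝ} (hp : p.Monic) {t : ℝ} :
    (t : ℂ) ∈ (p.map Complex.ofRealHom).roots ↔ p.eval t = 0 := by
  rw [Polynomial.mem_roots (hp.map _).ne_zero, Polynomial.IsRoot.def, ← Complex.ofRealHom_eq_coe,
    Polynomial.eval_map_apply, map_eq_zero]

theorem rootMultiplicity_map_eq_one_iff {p : Polynomial ℝ} (hp : p.Monic) {t : ℝ}
    (ht : p.eval t = 0) :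
    (p.map Complex.ofRealHom).rootMultiplicity (t : ℂ) = 1 ↔ p.derivative.eval t ≠ 0 := by
  have hne := (hp.map Complex.ofRealHom).ne_zero
  have hroot : (p.map Complex.ofRealHom).IsRoot (t : ℂ) :=
    (Polynomial.mem_roots hne).1 ((ofReal_mem_roots_map hp).2 ht)
  have hpos := (Polynomial.rootMultiplicity_pos hne).2 hroot
  have hlt := Polynomial.one_lt_rootMultiplicity_iff_isRoot (t := (t : ℂ)) hne
  rw [and_iff_right hroot, Polynomial.derivative_map, Polynomial.IsRoot.def,
    ← Complex.ofRealHom_eq_coe, Polynomial.eval_map_apply, map_eq_zero,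
    Complex.ofRealHom_eq_coe] at hlt
  rw [Ne, ← hlt]
  omega

theorem exists_gt_eval_eq_zero {p : Polynomial ℝ} (hp : p.Monic) {a : ℝ} (ha : p.eval a < 0) :
    ∃ t, a < t ∧ p.eval t = 0 := by
  have hdeg : 0 < p.degree := by
    rw [hp.degree_pos]
    rintro rfl
    rw [Polynomial.eval_one] at ha
    linarith
  have htend := Polynomial.tendsto_atTop_of_leadingCoeff_nonneg p hdeg
    (hp.leadingCoeff.symm ▸ zero_le_one)
  obtain ⟨b, hb, hab⟩ := ((htend.eventually_ge_atTop 0).and (Filter.eventually_gt_atTop a)).exists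
  obtain ⟨t, ht, h0⟩ := intermediate_value_Icc hab.le p.continuous.continuousOn ⟨ha.le, hb⟩
  refine ⟨t, lt_of_le_of_ne ht.1 ?_, h0⟩
  rintro rfl
  exact ha.ne h0

theorem exists_mem_Ioo_eval_eq_zero {p : Polynomial ℝ} {a b : ℝ} (hab : a < b)
    (ha : p.eval a = 0) (hd : 0 < p.derivative.eval a) (hb : p.eval b < 0) :
    ∃ t ∈ Set.Ioo a b, p.eval t = 0 := by
  have hslope := ((p.hasDerivAt a).tendsto_slope.mono_left
    (nhdsGT_le_nhdsNE a)).eventually_const_lt hd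
  obtain ⟨s, hs, hsab⟩ := (hslope.and (Ioo_mem_nhdsGT hab)).exists
  rw [slope_def_field, ha, sub_zero] at hs
  have hs0 : 0 < p.eval s := (div_pos_iff_of_pos_right (sub_pos.2 hsab.1)).1 hs
  obtain ⟨t, ht, h0⟩ :=
    intermediate_value_Icc' hsab.2.le p.continuous.continuousOn ⟨hb.le, hs0.le⟩
  refine ⟨t, ⟨hsab.1.trans_le ht.1, lt_of_le_of_ne ht.2 ?_⟩, h0⟩
  rintro rfl
  exact hb.ne h0

theorem eval_secularPoly_neg_lt_zero {n : ℕ} {lam c : Fin n → ℝ} {r : ℝ} (hr : r ≠ 0) {k : Fin n}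
    (hk : c k ≠ 0) (hlam : ∀ j, j ≠ k → lam j ≠ lam k) :
    (secularPoly lam c r).eval (-lam k) < 0 := by
  rw [eval_secularPoly_neg, neg_lt_zero]
  have : 0 < ∏ j ∈ Finset.univ.erase k, (-lam k + lam j) ^ 2 := Finset.prod_pos fun j hj => by
    have : -lam k + lam j ≠ 0 := fun h => hlam j (Finset.ne_of_mem_erase hj) (by linarith)
    positivity
  positivity

/-- A zero of the secular function between the two smallest `-λᵢ` with positive slope is a
second-rightmost root. -/
theorem exists_rightmost_root_of_secular {n : ℕ} {lam c : Fin n → ℝ} {r μ : ℝ} (hr : r ≠ 0)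
    (hmon : (secularPoly lam c r).Monic) {k : Fin n} (hk : c k ≠ 0) (hkμ : lam k + μ < 0)
    (hμ : ∀ i, i ≠ k → 0 < lam i + μ) (hsum : ∑ i, c i ^ 2 / (lam i + μ) ^ 2 = r ^ 2)
    (hslope : ∑ i, c i ^ 2 / (lam i + μ) ^ 3 < 0) :
    ∃ μ₁ ∈ ((secularPoly lam c r).map Complex.ofRealHom).roots,
      (∀ z ∈ ((secularPoly lam c r).map Complex.ofRealHom).roots, z.re ≤ μ₁.re) ∧
      (μ : ℂ) ∈ ((secularPoly lam c r).map Complex.ofRealHom).roots.erase μ₁ ∧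
      ∀ z ∈ ((secularPoly lam c r).map Complex.ofRealHom).roots.erase μ₁, z.re ≤ μ := by
  have hμ0 : ∀ i, lam i + μ ≠ 0 := fun i => by
    by_cases h : i = k
    · exact h ▸ hkμ.ne
    · exact (hμ i h).ne'
  have hlam : ∀ j, j ≠ k → lam k < lam j := fun j hj => by linarith [hμ j hj]
  have hneg := eval_secularPoly_neg_lt_zero hr hk fun j hj => (hlam j hj).ne'
  obtain ⟨t₁, ht₁, h₁⟩ := exists_gt_eval_eq_zero hmon hneg
  have hpos : ∀ {s : ℝ}, -lam k < s → ∀ i, 0 < lam i + s := fun {s} hs i => by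
    by_cases h : i = k
    · subst h
      linarith
    · linarith [hlam i h]
  have hsum₁ := (eval_secularPoly_eq_zero_iff hr fun i => (hpos ht₁ i).ne').1 h₁
  have huniq : ∀ z ∈ ((secularPoly lam c r).map Complex.ofRealHom).roots, μ < z.re → z = t₁ := by
    intro z hz hre
    have hroot := ((Polynomial.mem_roots (hmon.map Complex.ofRealHom).ne_zero).1 hz).eq_zero
    by_cases hzk : -lam k < z.re
    · refine eq_of_secular_sum_eq (hpos ht₁) (hpos hzk) hk ?_
      rw [hsum₁]
      exact (eval_map_secularPoly_eq_zero_iff hr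
        fun i => ofReal_add_ne_zero (Or.inl (hpos hzk i).ne')).1 hroot
    · exfalso
      by_cases him : z.im = 0
      · obtain ⟨t, rfl⟩ : ∃ t : ℝ, z = t := ⟨z.re, Complex.ext rfl him⟩
        rw [ofReal_re] at hre hzk
        have ht := (ofReal_mem_roots_map hmon).1 hz
        have htk : t < -lam k := lt_of_le_of_ne (not_lt.1 hzk) fun h => by
          rw [h] at ht
          exact hneg.ne ht
        have hsign : ∀ i, 0 < (lam i + μ) * (lam i + t) := fun i => by
          by_cases h : i = k
          · subst h
            exact mul_pos_of_neg_of_neg hkμ (by linarith)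
          · exact mul_pos (hμ i h) (by linarith [hμ i h])
        have htan := secular_sum_tangent_le (c := c) hsign
        rw [(eval_secularPoly_eq_zero_iff hr fun i => right_ne_zero_of_mul (hsign i).ne').1 ht,
          hsum] at htan
        nlinarith
      · refine secular_sum_ne_of_im_ne_zero hμ0 him (fun i => ?_) hk ?_
        · by_cases h : i = k
          · subst h
            exact mul_nonneg_of_nonpos_of_nonpos hkμ.le (by linarith)
          · exact (mul_pos (hμ i h) (by linarith [hμ i h])).le
        · rw [hsum]
          exact (eval_map_secularPoly_eq_zero_iff hr
            fun i => ofReal_add_ne_zero (Or.inr him)).1 hroot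
  have hμt : μ < t₁ := by linarith
  have hmult : ((secularPoly lam c r).map Complex.ofRealHom).rootMultiplicity (t₁ : ℂ) = 1 := by
    rw [rootMultiplicity_map_eq_one_iff hmon h₁,
      eval_derivative_secularPoly hr (fun i => (hpos ht₁ i).ne') hsum₁]
    have hD : 0 < ∏ i, (lam i + t₁) ^ 2 := Finset.prod_pos fun i _ => pow_pos (hpos ht₁ i) 2
    have : 0 < ∑ i, c i ^ 2 / (lam i + t₁) ^ 3 :=
      Finset.sum_pos' (fun i _ => div_nonneg (sq_nonneg _) (pow_pos (hpos ht₁ i) 3).le)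
        ⟨k, Finset.mem_univ k, div_pos (by positivity) (pow_pos (hpos ht₁ k) 3)⟩
    positivity
  refine ⟨t₁, (ofReal_mem_roots_map hmon).2 h₁, fun z hz => ?_, ?_, fun z hz => ?_⟩
  · rcases lt_or_ge μ z.re with h | h
    · rw [huniq z hz h]
    · rw [ofReal_re]
      linarith
  · rw [Multiset.mem_erase_of_ne (ofReal_injective.ne hμt.ne), ofReal_mem_roots_map hmon]
    exact (eval_secularPoly_eq_zero_iff hr hμ0).2 hsum
  · by_contra! h
    rw [huniq z (Multiset.mem_of_mem_erase hz) h, ← Multiset.count_pos, Multiset.count_erase_self,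
      Polynomial.count_roots, hmult] at hz
    omega

/-- If all roots but one lie weakly to the left of a simple real root `m`, then at most one of the
`-λᵢ` lies to the right of `m`. -/
theorem not_two_poles_right {n : ℕ} {lam c : Fin n → ℝ} {r m : ℝ} (hr : r ≠ 0)
    (hmon : (secularPoly lam c r).Monic) (hdeg : (secularPoly lam c r).natDegree = n + n)
    (hm : ∀ i, lam i + m ≠ 0) (hsum : ∑ i, c i ^ 2 / (lam i + m) ^ 2 = r ^ 2)
    {k : Fin n} (hk : c k ≠ 0) {μ₁ : ℂ} {E : Multiset ℂ}
    (hroots : ((secularPoly lam c r).map Complex.ofRealHom).roots = (m : ℂ) ::ₘ μ₁ ::ₘ E)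
    (hμ₁ : μ₁.re ≠ m) (hE : ∀ z ∈ E, z.re < m) {i j : Fin n} (hij : i ≠ j)
    (hi : lam i + m < 0) (hj : lam j + m < 0) : False := by
  set p := (secularPoly lam c r).map Complex.ofRealHom with hp
  have hpmon : p.Monic := hmon.map _
  have hsplit : p.Splits := IsAlgClosed.splits p
  have hcard : E.card + 2 = n + n := by
    rw [← hdeg, ← Polynomial.natDegree_map Complex.ofRealHom, ← hp, hsplit.natDegree_eq_card_roots,
      hroots, Multiset.card_cons, Multiset.card_cons]
  set S : Multiset ℂ := μ₁ ::ₘ E with hS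
  set T : Multiset ℂ := (Finset.univ : Finset (Fin n)).val.map fun i => -(lam i : ℂ) with hT
  have hSre : ∀ ρ ∈ S, ρ.re ≠ m := fun ρ hρ => by
    rcases Multiset.mem_cons.1 hρ with rfl | hρ
    · exact hμ₁
    · exact (hE ρ hρ).ne
  have hTre : ∀ ρ ∈ T, ρ.re ≠ m := fun ρ hρ => by
    obtain ⟨i, -, rfl⟩ := Multiset.mem_map.1 hρ
    intro h
    apply hm i
    rw [neg_re, ofReal_re] at h
    linarith
  have hre : ∀ b : ℝ, ((m : ℂ) + b * I).re = m := fun b => by simp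
  have him : ∀ b : ℝ, ((m : ℂ) + b * I).im = b := fun b => by simp
  have key := sum_sign_sub_lt_three (m := m) hSre hTre (f := fun b =>
      1 - ((r : ℂ) ^ 2)⁻¹ * ∑ i, (c i : ℂ) ^ 2 / ((lam i : ℂ) + ((m : ℂ) + b * I)) ^ 2)
    (fun b hb => by
      have hnorm := norm_secular_sum_lt (lam := lam) (c := c) (z := (m : ℂ) + b * I)
        (fun i => by rw [hre]; exact hm i) (by rw [him]; exact hb) hk
      rw [hre, hsum] at hnorm
      have hlt := (re_le_norm _).trans_lt hnorm
      rw [← ofReal_pow, ← ofReal_inv, sub_re, one_re, re_ofReal_mul, sub_pos,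
        inv_mul_lt_iff₀ (by positivity), mul_one]
      exact hlt)
    (fun b hb => by
      have hne : ∀ i, (lam i : ℂ) + ((m : ℂ) + b * I) ≠ 0 := fun i =>
        ofReal_add_ne_zero (Or.inr (by rw [him]; exact hb))
      have heval := eval_map_secularPoly lam c r hne
      rw [← hp, hsplit.eval_eq_prod_roots_of_monic hpmon, hroots, Multiset.map_cons,
        Multiset.prod_cons, add_sub_cancel_left, Finset.prod_pow] at heval
      rw [heval, hT, Multiset.map_map]
      congr 2
      refine Finset.prod_congr rfl fun i _ => ?_
      simp only [Function.comp_apply]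
      ring)
  have hSsum : (n + n : ℝ) - 3 ≤ (S.map fun ρ => Real.sign (m - ρ.re)).sum := by
    have hEsum : (E.map fun ρ => Real.sign (m - ρ.re)).sum = (E.card : ℝ) := by
      rw [Multiset.map_congr rfl fun ρ hρ => Real.sign_of_pos (sub_pos.2 (hE ρ hρ))]
      simp
    have hcard' : (E.card : ℝ) + 2 = n + n := by exact_mod_cast hcard
    have hsign : -1 ≤ Real.sign (m - μ₁.re) := by
      rcases Real.sign_apply_eq (m - μ₁.re) with h | h | h <;> rw [h] <;> norm_num
    rw [hS, Multiset.map_cons, Multiset.sum_cons, hEsum]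
    linarith
  have hTsum : (T.map fun ρ => Real.sign (m - ρ.re)).sum ≤ (n : ℝ) - 4 := by
    rw [hT, Multiset.map_map]
    change ∑ l, Real.sign (m - (-(lam l : ℂ)).re) ≤ _
    have hle : ∀ l ∈ Finset.univ, Real.sign (m - (-(lam l : ℂ)).re) ≤
        1 - (if l = i then 2 else 0) - (if l = j then 2 else 0) := fun l _ => by
      rw [neg_re, ofReal_re, sub_neg_eq_add, add_comm]
      by_cases hli : l = i
      · subst hli
        rw [Real.sign_of_neg hi, if_pos rfl, if_neg hij]
        norm_num
      · by_cases hlj : l = j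
        · subst hlj
          rw [Real.sign_of_neg hj, if_pos rfl, if_neg hli]
          norm_num
        · rw [if_neg hli, if_neg hlj]
          rcases Real.sign_apply_eq (lam l + m) with h | h | h <;> rw [h] <;> norm_num
    refine (Finset.sum_le_sum hle).trans_eq ?_
    rw [Finset.sum_sub_distrib, Finset.sum_sub_distrib, Finset.sum_ite_eq', Finset.sum_ite_eq']
    simp
    ring
  linarith

theorem neg_mem_roots_erase {p : Polynomial ℝ} (hp : p.Monic) {l : ℝ}
    (hl : (Polynomial.X + Polynomial.C l) ^ 2 ∣ p) (μ₁ : ℂ) :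
    ((-l : ℝ) : ℂ) ∈ (p.map Complex.ofRealHom).roots.erase μ₁ := by
  have hdvd := Polynomial.map_dvd Complex.ofRealHom hl
  have hmap : ((Polynomial.X + Polynomial.C l) ^ 2).map Complex.ofRealHom =
      (Polynomial.X - Polynomial.C ((-l : ℝ) : ℂ)) ^ 2 := by
    simp
  rw [hmap, ← Polynomial.le_rootMultiplicity_iff (hp.map _).ne_zero, ← Polynomial.count_roots]
    at hdvd
  rw [← Multiset.count_pos]
  by_cases h : ((-l : ℝ) : ℂ) = μ₁
  · rw [← h, Multiset.count_erase_self]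
    omega
  · rw [Multiset.count_erase_of_ne h]
    omega

/-- A simple real second-rightmost root that is not a `-λᵢ` lies between the two smallest `-λᵢ`
and has positive slope. -/
theorem secular_of_secondRightmost_root {n : ℕ} {lam c : Fin n → ℝ} {r m : ℝ} (hr : r ≠ 0)
    (hmon : (secularPoly lam c r).Monic) (hdeg : (secularPoly lam c r).natDegree = n + n)
    {k k' : Fin n} (hkk' : k' ≠ k) (hk : ∀ i, lam k ≤ lam i)
    (hm : ∀ i, lam i + m ≠ 0) {μ₁ : ℂ}
    (hμ₁ : μ₁ ∈ ((secularPoly lam c r).map Complex.ofRealHom).roots)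
    (hmax : ∀ z ∈ ((secularPoly lam c r).map Complex.ofRealHom).roots, z.re ≤ μ₁.re)
    (hmem : (m : ℂ) ∈ ((secularPoly lam c r).map Complex.ofRealHom).roots.erase μ₁)
    (hle : ∀ z ∈ ((secularPoly lam c r).map Complex.ofRealHom).roots.erase μ₁, z.re ≤ m)
    (hsimple : ((secularPoly lam c r).map Complex.ofRealHom).rootMultiplicity (m : ℂ) = 1) :
    c k ≠ 0 ∧ -lam k' < m ∧ m < -lam k ∧ ∑ i, c i ^ 2 / (lam i + m) ^ 2 = r ^ 2 ∧
      ∑ i, c i ^ 2 / (lam i + m) ^ 3 < 0 := by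
  set p := (secularPoly lam c r).map Complex.ofRealHom with hp
  have hpmon : p.Monic := hmon.map _
  have hm_root := Multiset.mem_of_mem_erase hmem
  have hm_eval := (ofReal_mem_roots_map hmon).1 hm_root
  have hsum := (eval_secularPoly_eq_zero_iff hr hm).1 hm_eval
  have hcount : p.roots.count (m : ℂ) = 1 := by rw [Polynomial.count_roots, hsimple]
  have hμ₁m : μ₁ ≠ m := by
    rintro rfl
    rw [← Multiset.count_pos, Multiset.count_erase_self, hcount] at hmem
    omega
  have hlevel : ∀ z ∈ p.roots, (∀ i, (lam i : ℂ) + z ≠ 0) →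
      ∑ i, (c i : ℂ) ^ 2 / ((lam i : ℂ) + z) ^ 2 =
        ((∑ i, c i ^ 2 / (lam i + m) ^ 2 : ℝ) : ℂ) := fun z hz hne => by
    rw [hsum]
    exact (eval_map_secularPoly_eq_zero_iff hr hne).1
      ((Polynomial.mem_roots hpmon.ne_zero).1 hz).eq_zero
  obtain ⟨l, hl⟩ : ∃ l, c l ≠ 0 := by
    by_contra! h
    simp only [h] at hsum
    exact pow_ne_zero 2 hr (by simpa using hsum.symm)
  have hmk : m < -lam k := by
    refine lt_of_le_of_ne (not_lt.1 fun h => ?_) fun h => hm k (by linarith)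
    have hposm : ∀ i, 0 < lam i + m := fun i => by linarith [hk i]
    have hposz : ∀ i, 0 < lam i + μ₁.re := fun i => by
      have := hmax _ hm_root
      rw [ofReal_re] at this
      linarith [hposm i]
    exact hμ₁m (eq_of_secular_sum_eq hposm hposz hl
      (hlevel μ₁ hμ₁ fun i => ofReal_add_ne_zero (Or.inl (hposz i).ne')))
  have hnodouble : ¬ (c k = 0 ∨ ∃ j, j ≠ k ∧ lam j = lam k) := fun h => by
    have := hle _ (neg_mem_roots_erase hmon (sq_dvd_secularPoly lam c r k h) μ₁)
    rw [ofReal_re] at this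
    linarith
  push Not at hnodouble
  obtain ⟨hck, hlamk⟩ := hnodouble
  have hline : ∀ z ∈ p.roots, z.re = m → z = m := fun z hz hzm => by
    refine Complex.ext hzm ?_
    rw [ofReal_im]
    by_contra him
    have hlt := norm_secular_sum_lt (lam := lam) (z := z) (fun i => by rw [hzm]; exact hm i) him hl
    rw [hlevel z hz fun i => ofReal_add_ne_zero (Or.inr him), hzm, hsum, norm_real,
      Real.norm_of_nonneg (sq_nonneg r)] at hlt
    exact lt_irrefl _ hlt
  have hk'm : -lam k' < m := by
    refine lt_of_le_of_ne (not_lt.1 fun h => ?_) fun h => hm k' (by linarith)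
    obtain ⟨E, hE⟩ := Multiset.exists_cons_of_mem hmem
    have hroots : p.roots = (m : ℂ) ::ₘ μ₁ ::ₘ E := by
      rw [← Multiset.cons_erase hμ₁, hE, Multiset.cons_swap]
    refine not_two_poles_right hr hmon hdeg hm hsum hl hroots (fun h => hμ₁m (hline μ₁ hμ₁ h))
      (fun z hz => ?_) hkk' (by linarith) (by linarith)
    have hz_erase : z ∈ p.roots.erase μ₁ := hE ▸ Multiset.mem_cons_of_mem hz
    refine lt_of_le_of_ne (hle z hz_erase) fun hzm => ?_
    rw [hline z (Multiset.mem_of_mem_erase hz_erase) hzm] at hz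
    rw [hroots, Multiset.count_cons_self] at hcount
    have := Multiset.count_pos.2 (Multiset.mem_cons_of_mem (b := μ₁) hz)
    omega
  refine ⟨hck, hk'm, hmk, hsum, ?_⟩
  by_contra! hnonneg
  have hder := (rootMultiplicity_map_eq_one_iff hmon hm_eval).1 hsimple
  rw [eval_derivative_secularPoly hr hm hsum] at hder
  have hD : 0 < ∏ i, (lam i + m) ^ 2 := Finset.prod_pos fun i _ => by
    have := hm i
    positivity
  have hder_pos : 0 < (secularPoly lam c r).derivative.eval m := by
    rw [eval_derivative_secularPoly hr hm hsum]
    have := lt_of_le_of_ne hnonneg (right_ne_zero_of_mul hder).symm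
    positivity
  have hneg := eval_secularPoly_neg_lt_zero hr hck hlamk
  obtain ⟨s, hs, hs0⟩ := exists_mem_Ioo_eval_eq_zero hmk hm_eval hder_pos hneg
  obtain ⟨t, ht, ht0⟩ := exists_gt_eval_eq_zero hmon hneg
  have honly : ∀ u : ℝ, (secularPoly lam c r).eval u = 0 → m < u → (u : ℂ) = μ₁ :=
    fun u hu hmu => by
    by_contra hne
    have := hle u ((Multiset.mem_erase_of_ne hne).2 ((ofReal_mem_roots_map hmon).2 hu))
    rw [ofReal_re] at this
    linarith
  have hst := ofReal_injective ((honly s hs0 hs.1).trans (honly t ht0 (by linarith)).symm)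
  linarith [hs.2]

/-! ### KKT points -/

theorem sum_sq_dotProduct_orthonormal {n : ℕ} {w : Fin n → Fin n → ℝ}
    (horth : ∀ i j, w i ⬝ᵥ w j = if i = j then (1 : ℝ) else 0) (x : Fin n → ℝ) :
    ∑ i, (w i ⬝ᵥ x) ^ 2 = x ⬝ᵥ x := by
  have hWW : (Matrix.of w)ᵀ * Matrix.of w = 1 := mul_eq_one_comm.1 <| by
    ext i j
    rw [Matrix.mul_apply', Matrix.one_apply]
    exact horth i j
  have h : (Matrix.of w *ᵥ x) ⬝ᵥ (Matrix.of w *ᵥ x) = x ⬝ᵥ x := by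
    rw [dotProduct_mulVec, ← mulVec_transpose, mulVec_mulVec, hWW, one_mulVec]
  rw [← h]
  exact Finset.sum_congr rfl fun i _ => pow_two _

theorem eq_zero_of_forall_dotProduct_eq_zero {n : ℕ} {w : Fin n → Fin n → ℝ}
    (horth : ∀ i j, w i ⬝ᵥ w j = if i = j then (1 : ℝ) else 0) {x : Fin n → ℝ}
    (hx : ∀ i, w i ⬝ᵥ x = 0) : x = 0 := by
  have h := sum_sq_dotProduct_orthonormal horth x
  simp only [hx] at h
  exact dotProduct_self_eq_zero.1 (by simpa using h.symm)

theorem dotProduct_mulVec_eigenvector {n : ℕ} {P : Matrix (Fin n) (Fin n) ℝ} (hP : P.IsSymm)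
    {l : ℝ} {v : Fin n → ℝ} (hv : P.mulVec v = l • v) (x : Fin n → ℝ) :
    v ⬝ᵥ P.mulVec x = l * (v ⬝ᵥ x) := by
  rw [dotProduct_mulVec, ← mulVec_transpose, hP.eq, hv, smul_dotProduct, smul_eq_mul]

theorem euclNorm_eq_iff {n : ℕ} {x : Fin n → ℝ} {r : ℝ} (hr : 0 < r) :
    euclNorm x = r ↔ x ⬝ᵥ x = r ^ 2 := by
  rw [euclNorm, Real.sqrt_eq_iff_mul_self_eq_of_pos hr, pow_two, eq_comm]

/-- Away from the eigenvalues of `-P`, the multipliers of KKT points are the real zeros of the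
secular function. -/
theorem exists_kkt_iff {n : ℕ} {P : Matrix (Fin n) (Fin n) ℝ} (hP : P.IsSymm) {lam : Fin n → ℝ}
    {w : Fin n → Fin n → ℝ} (heig : ∀ i, P.mulVec (w i) = lam i • w i)
    (horth : ∀ i j, w i ⬝ᵥ w j = if i = j then (1 : ℝ) else 0) (q : Fin n → ℝ) {r : ℝ}
    (hr : 0 < r) {μ : ℝ} (hμ : ∀ i, lam i + μ ≠ 0) :
    (∃ x : Fin n → ℝ, P.mulVec x + q + μ • x = 0 ∧ euclNorm x = r) ↔
      ∑ i, (w i ⬝ᵥ q) ^ 2 / (lam i + μ) ^ 2 = r ^ 2 := by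
  have hcoord : ∀ x i, w i ⬝ᵥ (P.mulVec x + q + μ • x) = (lam i + μ) * (w i ⬝ᵥ x) + w i ⬝ᵥ q :=
    fun x i => by
    rw [dotProduct_add, dotProduct_add, dotProduct_mulVec_eigenvector hP (heig i),
      dotProduct_smul, smul_eq_mul]
    ring
  have hnorm : ∀ x, (∀ i, (lam i + μ) * (w i ⬝ᵥ x) + w i ⬝ᵥ q = 0) →
      ∑ i, (w i ⬝ᵥ q) ^ 2 / (lam i + μ) ^ 2 = x ⬝ᵥ x := fun x hx => by
    rw [← sum_sq_dotProduct_orthonormal horth]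
    refine Finset.sum_congr rfl fun i _ => ?_
    rw [eq_neg_of_add_eq_zero_right (hx i), div_eq_iff (pow_ne_zero 2 (hμ i))]
    ring
  constructor
  · rintro ⟨x, hx, hxr⟩
    rw [hnorm x fun i => by rw [← hcoord, hx, dotProduct_zero], (euclNorm_eq_iff hr).1 hxr]
  · intro h
    obtain ⟨x, hx⟩ : ∃ x : Fin n → ℝ, ∀ i, w i ⬝ᵥ x = -(w i ⬝ᵥ q) / (lam i + μ) := by
      have hWW : Matrix.of w * (Matrix.of w)ᵀ = 1 := by
        ext i j
        rw [Matrix.mul_apply', Matrix.one_apply]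
        exact horth i j
      refine ⟨(Matrix.of w)ᵀ *ᵥ fun i => -(w i ⬝ᵥ q) / (lam i + μ), fun i => ?_⟩
      have := congrFun (mulVec_mulVec (fun i => -(w i ⬝ᵥ q) / (lam i + μ)) (Matrix.of w)
        (Matrix.of w)ᵀ) i
      rw [hWW, one_mulVec] at this
      exact this
    have hx' : ∀ i, (lam i + μ) * (w i ⬝ᵥ x) + w i ⬝ᵥ q = 0 := fun i => by
      rw [hx, mul_div_cancel₀ _ (hμ i), neg_add_cancel]
    refine ⟨x, eq_zero_of_forall_dotProduct_eq_zero horth fun i => by rw [hcoord, hx' i], ?_⟩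
    rw [euclNorm_eq_iff hr, ← hnorm x hx', h]

theorem isEig_neg_iff {n : ℕ} {P : Matrix (Fin n) (Fin n) ℝ} (hP : P.IsSymm) {lam : Fin n → ℝ}
    {w : Fin n → Fin n → ℝ} (heig : ∀ i, P.mulVec (w i) = lam i • w i)
    (horth : ∀ i j, w i ⬝ᵥ w j = if i = j then (1 : ℝ) else 0) (μ : ℝ) :
    IsEig ((-P).map Complex.ofReal) (μ : ℂ) ↔ ∃ i, lam i + μ = 0 := by
  have hreal : ∀ (v : Fin n → ℂ) j, ((-P).map Complex.ofReal *ᵥ v) j =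
      ∑ l, ((-P j l : ℝ) : ℂ) * v l := fun v j => rfl
  constructor
  · rintro ⟨v, hv0, hv⟩
    by_contra! hne
    have hzero : ∀ x : Fin n → ℝ, (∀ j, ∑ l, -P j l * x l = μ * x j) → x = 0 := fun x hx =>
      eq_zero_of_forall_dotProduct_eq_zero horth fun i => by
        have hPx : P.mulVec x = -(μ • x) := by
          ext j
          have := hx j
          simp only [neg_mul, Finset.sum_neg_distrib] at this
          simp only [Pi.neg_apply, Pi.smul_apply, smul_eq_mul, ← this, neg_neg]
          rfl
        have h := dotProduct_mulVec_eigenvector hP (heig i) x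
        rw [hPx, dotProduct_neg, dotProduct_smul, smul_eq_mul] at h
        refine (mul_eq_zero.1 (?_ : (lam i + μ) * _ = 0)).resolve_left (hne i)
        linarith
    have hre := hzero (fun l => (v l).re) fun j => by
      have := congrArg Complex.re (congrFun hv j)
      rw [hreal, re_sum] at this
      simpa only [re_ofReal_mul, Pi.smul_apply, smul_eq_mul] using this
    have him := hzero (fun l => (v l).im) fun j => by
      have := congrArg Complex.im (congrFun hv j)
      rw [hreal, im_sum] at this
      simpa only [im_ofReal_mul, Pi.smul_apply, smul_eq_mul] using this
    exact hv0 (funext fun l => Complex.ext (congrFun hre l) (congrFun him l))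
  · rintro ⟨i, hi⟩
    refine ⟨fun l => (w i l : ℂ), fun h => ?_, funext fun j => ?_⟩
    · have hw : w i = 0 := funext fun l => ofReal_injective (congrFun h l)
      have := horth i i
      rw [hw, dotProduct_zero, if_pos rfl] at this
      exact zero_ne_one this
    · have hj : ∑ l, P j l * w i l = lam i * w i j := congrFun (heig i) j
      rw [hreal, Pi.smul_apply, smul_eq_mul, show μ = -lam i by linarith]
      rw [← ofReal_mul, neg_mul, ← hj, ← Finset.sum_neg_distrib, ofReal_sum]
      exact Finset.sum_congr rfl fun l _ => by push_cast; ring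

theorem not_hardCase_of_dotProduct_ne_zero {n : ℕ} {P : Matrix (Fin n) (Fin n) ℝ} (hP : P.IsSymm)
    {l : ℝ} {v : Fin n → ℝ} (hv : P.mulVec v = l • v) {q : Fin n → ℝ} (hq : v ⬝ᵥ q ≠ 0) (r : ℝ) :
    ¬ HardCase P q r l := by
  rintro ⟨x, μ, hx, -, -, rfl⟩
  apply hq
  have h : v ⬝ᵥ (P.mulVec x + q + -l • x) = 0 := by rw [hx, dotProduct_zero]
  rw [dotProduct_add, dotProduct_add, dotProduct_mulVec_eigenvector hP hv, dotProduct_smul,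
    smul_eq_mul] at h
  linarith

/-- (T) possesses a KKT point `(x, μ)` with `w₁ᵀq ≠ 0`, `μ ∈ (-λ₂, -λ₁)` and
`s'(μ) > 0` (i.e., a second-order sufficient local-nonglobal minimizer) iff (T) is not in
the hard case and the second-rightmost eigenvalue of `M` is real, simple, and not an
eigenvalue of `-P`; moreover, when such a minimizer exists, its Lagrange multiplier `μ`
equals this second-rightmost eigenvalue. -/
theorem stmt_0 {n : ℕ} (hn : 1 < n)
    (P : Matrix (Fin n) (Fin n) ℝ) (hP : P.IsSymm)
    (lam : Fin n → ℝ) (w : Fin n → Fin n → ℝ)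
    (hmono : Monotone lam)
    (heig : ∀ i, P.mulVec (w i) = lam i • w i)
    (horth : ∀ i j, w i ⬝ᵥ w j = if i = j then (1 : ℝ) else 0)
    (q : Fin n → ℝ) (r : ℝ) (hr : 0 < r) :
    ((∃ (x : Fin n → ℝ) (μ : ℝ),
        P.mulVec x + q + μ • x = 0 ∧ euclNorm x = r ∧
        w ⟨0, by omega⟩ ⬝ᵥ q ≠ 0 ∧
        -(lam ⟨1, hn⟩) < μ ∧ μ < -(lam ⟨0, by omega⟩) ∧
        0 < secularDeriv lam w q μ)
      ↔ (¬ HardCase P q r (lam ⟨0, by omega⟩) ∧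
          ∃ μ₂ : ℂ, SecondRightmost P q r μ₂ ∧ μ₂.im = 0 ∧
            Polynomial.rootMultiplicity μ₂ (trsMC P q r).charpoly = 1 ∧
            ¬ IsEig ((-P).map Complex.ofReal) μ₂))
    ∧ (∀ (x : Fin n → ℝ) (μ : ℝ),
        P.mulVec x + q + μ • x = 0 → euclNorm x = r →
        w ⟨0, by omega⟩ ⬝ᵥ q ≠ 0 →
        -(lam ⟨1, hn⟩) < μ → μ < -(lam ⟨0, by omega⟩) →
        0 < secularDeriv lam w q μ →
        SecondRightmost P q r (μ : ℂ)) := by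
  have hn0 : 0 < n := by omega
  have hr0 := hr.ne'
  have hpoly : (trsM P q r).charpoly = secularPoly lam (fun i => w i ⬝ᵥ q) r :=
    charpoly_trsM P lam w heig horth hP q r
  have hmap : (trsMC P q r).charpoly =
      (secularPoly lam (fun i => w i ⬝ᵥ q) r).map Complex.ofRealHom := by
    rw [charpoly_trsMC, hpoly]
  have hmon : (secularPoly lam (fun i => w i ⬝ᵥ q) r).Monic := hpoly ▸ charpoly_monic _
  have hdeg : (secularPoly lam (fun i => w i ⬝ᵥ q) r).natDegree = n + n := by
    rw [← hpoly, charpoly_natDegree_eq_dim, Fintype.card_sum, Fintype.card_fin]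
  have hge0 : ∀ i, lam ⟨0, hn0⟩ ≤ lam i := fun i => hmono (Fin.mk_le_of_le_val (Nat.zero_le _))
  have hge1 : ∀ i, i ≠ ⟨0, hn0⟩ → lam ⟨1, hn⟩ ≤ lam i := fun i hi =>
    hmono (Fin.mk_le_of_le_val (Nat.one_le_iff_ne_zero.2 fun h => hi (Fin.ext h)))
  have hne : ∀ {μ : ℝ}, -lam ⟨1, hn⟩ < μ → μ < -lam ⟨0, hn0⟩ → ∀ i, lam i + μ ≠ 0 :=
    fun {μ} h1 h0 i => by
    by_cases hi : i = ⟨0, hn0⟩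
    · subst hi
      linarith
    · linarith [hge1 i hi]
  have hsecond : ∀ (x : Fin n → ℝ) (μ : ℝ), P.mulVec x + q + μ • x = 0 → euclNorm x = r →
      w ⟨0, hn0⟩ ⬝ᵥ q ≠ 0 → -lam ⟨1, hn⟩ < μ → μ < -lam ⟨0, hn0⟩ → 0 < secularDeriv lam w q μ →
      SecondRightmost P q r (μ : ℂ) := by
    intro x μ hx hxr hq h1 h0 hs
    rw [SecondRightmost, hmap]
    exact exists_rightmost_root_of_secular hr0 hmon hq (by linarith)
      (fun i hi => by linarith [hge1 i hi])
      ((exists_kkt_iff hP heig horth q hr (hne h1 h0)).1 ⟨x, hx, hxr⟩)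
      (by rw [secularDeriv] at hs; linarith)
  refine ⟨⟨?_, ?_⟩, hsecond⟩
  · rintro ⟨x, μ, hx, hxr, hq, h1, h0, hs⟩
    refine ⟨not_hardCase_of_dotProduct_ne_zero hP (heig _) hq r, μ,
      hsecond x μ hx hxr hq h1 h0 hs, ofReal_im μ, ?_, ?_⟩
    · have hsum := (exists_kkt_iff hP heig horth q hr (hne h1 h0)).1 ⟨x, hx, hxr⟩
      rw [hmap, rootMultiplicity_map_eq_one_iff hmon
        ((eval_secularPoly_eq_zero_iff hr0 (hne h1 h0)).2 hsum),
        eval_derivative_secularPoly hr0 (hne h1 h0) hsum]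
      refine mul_ne_zero (mul_ne_zero ?_ (by positivity)) fun h => ?_
      · exact Finset.prod_ne_zero_iff.2 fun i _ => pow_ne_zero 2 (hne h1 h0 i)
      · rw [secularDeriv, h, mul_zero] at hs
        exact lt_irrefl _ hs
    · rw [isEig_neg_iff hP heig horth]
      rintro ⟨i, hi⟩
      exact hne h1 h0 i hi
  · rintro ⟨-, μ₂, ⟨μ₁, hμ₁, hmax, hmem, hle⟩, him, hmult, hnot⟩
    obtain ⟨m, rfl⟩ : ∃ m : ℝ, μ₂ = m := ⟨μ₂.re, Complex.ext rfl him⟩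
    rw [isEig_neg_iff hP heig horth, not_exists] at hnot
    rw [hmap] at hμ₁ hmax hmem hle hmult
    obtain ⟨hq, h1, h0, hsum, hslope⟩ := secular_of_secondRightmost_root hr0 hmon hdeg
      (k := ⟨0, hn0⟩) (k' := ⟨1, hn⟩) (by simp) hge0 hnot hμ₁ hmax hmem hle hmult
    obtain ⟨x, hx, hxr⟩ := (exists_kkt_iff hP heig horth q hr hnot).2 hsum
    exact ⟨x, m, hx, hxr, hq, h1, h0, by rw [secularDeriv]; linarith⟩
end

section
/- Suppose wᵀ₁q ≠ 0, wᵀ₂q ≠ 0, λ₁ ≠ λ₂, and μ ∈ ℝ is a simple root of s that is the second-rightmost root of s in ℂ (i.e., exactly one root of s, counted with multiplicity, has real part greater than μ). Then μ ≥ −λ₂. -/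
open Matrix Complex
open scoped Classical

open Polynomial Filter Topology

/-- A sum of double poles at the points of `T` with weights `m`, shifted by a constant. -/
noncomputable def doublePoleSum (T : Finset ℝ) (m : ℝ → ℝ) (ρ : ℝ) (z : ℂ) : ℂ :=
  (∑ p ∈ T, (m p : ℂ) / (z - p) ^ 2) - ρ

/-- The common denominator of `doublePoleSum`. -/
noncomputable def doublePoleDen (T : Finset ℝ) : ℂ[X] :=
  ∏ p ∈ T, (X - C (p : ℂ)) ^ 2

/-- The numerator of `doublePoleSum`. -/
noncomputable def doublePoleNum (T : Finset ℝ) (m : ℝ → ℝ) (ρ : ℝ) : ℂ[X] :=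
  (∑ p ∈ T, C (m p : ℂ) * doublePoleDen (T.erase p)) - C (ρ : ℂ) * doublePoleDen T

lemma doublePoleDen_eval_ne_zero {T : Finset ℝ} {z : ℂ} (hz : ∀ p ∈ T, z ≠ (p : ℂ)) :
    (doublePoleDen T).eval z ≠ 0 := by
  simp only [doublePoleDen, eval_prod, eval_pow, eval_sub, eval_X, eval_C]
  exact Finset.prod_ne_zero_iff.2 fun p hp => pow_ne_zero _ (sub_ne_zero.2 (hz p hp))

lemma doublePoleDen_eval_erase {T : Finset ℝ} {p : ℝ} (hp : p ∈ T) (z : ℂ) :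
    (doublePoleDen T).eval z = (z - p) ^ 2 * (doublePoleDen (T.erase p)).eval z := by
  rw [doublePoleDen, ← Finset.mul_prod_erase T _ hp]
  simp [doublePoleDen]

lemma doublePoleNum_eval {T : Finset ℝ} (m : ℝ → ℝ) (ρ : ℝ) {z : ℂ}
    (hz : ∀ p ∈ T, z ≠ (p : ℂ)) :
    (doublePoleNum T m ρ).eval z = (doublePoleDen T).eval z * doublePoleSum T m ρ z := by
  simp only [doublePoleNum, doublePoleSum, eval_sub, eval_mul, eval_C, eval_finsetSum, mul_sub,
    Finset.mul_sum]
  rw [mul_comm (ρ : ℂ)]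
  congr 1
  refine Finset.sum_congr rfl fun p hp => ?_
  have h := sub_ne_zero.2 (hz p hp)
  rw [doublePoleDen_eval_erase hp]
  field_simp

lemma doublePoleNum_eval_ne_zero_of_mem {T : Finset ℝ} {m : ℝ → ℝ} (hm : ∀ p ∈ T, 0 < m p)
    (ρ : ℝ) {p : ℝ} (hp : p ∈ T) : (doublePoleNum T m ρ).eval (p : ℂ) ≠ 0 := by
  have hT : (doublePoleDen T).eval (p : ℂ) = 0 := by
    rw [doublePoleDen_eval_erase hp]; simp
  have : (doublePoleNum T m ρ).eval (p : ℂ)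
      = (m p : ℂ) * (doublePoleDen (T.erase p)).eval (p : ℂ) := by
    simp only [doublePoleNum, eval_sub, eval_mul, eval_C, eval_finsetSum, hT, mul_zero, sub_zero]
    refine Finset.sum_eq_single p (fun b _ hbp => ?_) (fun h => absurd hp h)
    rw [doublePoleDen_eval_erase (Finset.mem_erase.2 ⟨hbp.symm, hp⟩)]
    simp
  rw [this]
  refine mul_ne_zero (by exact_mod_cast (hm p hp).ne') (doublePoleDen_eval_ne_zero ?_)
  intro b hb h
  exact (Finset.mem_erase.1 hb).1 (by exact_mod_cast h.symm)

lemma eventually_nhdsNE_forall_ne (T : Finset ℝ) (z : ℂ) :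
    ∀ᶠ u in 𝓝[≠] z, ∀ p ∈ T, u ≠ (p : ℂ) := by
  refine (Filter.eventually_all_finset T).2 fun p _ => ?_
  by_cases h : z = p
  · subst h; exact eventually_mem_nhdsWithin
  · exact nhdsWithin_le_nhds (isOpen_ne.mem_nhds h)

/-- A simple zero of `doublePoleSum` is a simple root of its numerator, and not a pole. -/
lemma HasZeroOfOrder.doublePoleNum_factor {T : Finset ℝ} {m : ℝ → ℝ} (hm : ∀ p ∈ T, 0 < m p)
    {ρ : ℝ} {z : ℂ} (h : HasZeroOfOrder (doublePoleSum T m ρ) z 1) :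
    (∀ p ∈ T, z ≠ (p : ℂ)) ∧ doublePoleSum T m ρ z = 0 ∧
      ∃ R : ℂ[X], doublePoleNum T m ρ = (X - C z) * R ∧ R.eval z ≠ 0 := by
  obtain ⟨g, hg, hgz, hev⟩ := h
  have hev' : ∀ᶠ u in 𝓝[≠] z, (doublePoleNum T m ρ).eval u
      = (u - z) * ((doublePoleDen T).eval u * g u) := by
    filter_upwards [nhdsWithin_le_nhds hev, eventually_nhdsNE_forall_ne T z] with u hu hT
    rw [doublePoleNum_eval m ρ hT, hu]; ring
  have c1 : ContinuousAt (fun u => (doublePoleDen T).eval u * g u) z :=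
    (doublePoleDen T).continuous.continuousAt.mul hg.continuousAt
  have c2 : ContinuousAt (fun u => (u - z) * ((doublePoleDen T).eval u * g u)) z :=
    (by fun_prop : ContinuousAt (fun u : ℂ => u - z) z).mul c1
  have h0 : (doublePoleNum T m ρ).eval z = 0 := by
    have l1 : Tendsto (fun u => (doublePoleNum T m ρ).eval u) (𝓝[≠] z)
        (𝓝 ((doublePoleNum T m ρ).eval z)) :=
      (doublePoleNum T m ρ).continuous.continuousAt.mono_left nhdsWithin_le_nhds
    have l2 := c2.tendsto.mono_left (nhdsWithin_le_nhds (s := {z}ᶜ))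
    simpa using tendsto_nhds_unique (l1.congr' hev') l2
  have hzT : ∀ p ∈ T, z ≠ (p : ℂ) := by
    rintro p hp rfl
    exact doublePoleNum_eval_ne_zero_of_mem hm ρ hp h0
  refine ⟨hzT, by simpa using hev.self_of_nhds, ?_⟩
  obtain ⟨R, hR⟩ := dvd_iff_isRoot.2 h0
  refine ⟨R, hR, ?_⟩
  have hRg : ∀ᶠ u in 𝓝[≠] z, R.eval u = (doublePoleDen T).eval u * g u := by
    filter_upwards [hev', eventually_mem_nhdsWithin] with u hu hne
    rw [hR, eval_mul] at hu
    simp only [eval_sub, eval_X, eval_C] at hu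
    exact mul_left_cancel₀ (sub_ne_zero.2 hne) hu
  have l1 : Tendsto (fun u => R.eval u) (𝓝[≠] z) (𝓝 (R.eval z)) :=
    R.continuous.continuousAt.mono_left nhdsWithin_le_nhds
  have l2 := c1.tendsto.mono_left (nhdsWithin_le_nhds (s := {z}ᶜ))
  rw [tendsto_nhds_unique (l1.congr' hRg) l2]
  exact mul_ne_zero (doublePoleDen_eval_ne_zero hzT) hgz

/-- If `0` is a zero of `doublePoleSum`, the real part is negative on the rest of the
imaginary axis. -/
lemma doublePoleSum_re_neg {T : Finset ℝ} (hT : T.Nonempty) {m : ℝ → ℝ}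
    (hm : ∀ p ∈ T, 0 < m p) {ρ : ℝ} (h0T : ∀ p ∈ T, (0 : ℂ) ≠ (p : ℂ))
    (h0 : doublePoleSum T m ρ 0 = 0) {y : ℝ} (hy : y ≠ 0) :
    (doublePoleSum T m ρ (y * I)).re < 0 := by
  have hρ : ρ = ∑ p ∈ T, m p / p ^ 2 := by
    have : ((∑ p ∈ T, m p / p ^ 2 : ℝ) : ℂ) - ρ = 0 := by
      rw [← h0, doublePoleSum]; push_cast; simp
    exact_mod_cast (sub_eq_zero.1 this).symm
  rw [doublePoleSum, sub_re, ofReal_re, sub_neg, re_sum, hρ]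
  refine Finset.sum_lt_sum_of_nonempty hT fun p hp => ?_
  have hp0 : p ≠ 0 := fun h => h0T p hp (by simp [h])
  refine (re_le_norm _).trans_lt ?_
  have : ‖(y * I - p : ℂ)‖ ^ 2 = y ^ 2 + p ^ 2 := by
    rw [Complex.sq_norm, normSq_apply]; simp; ring
  rw [norm_div, norm_pow, this, norm_real, Real.norm_of_nonneg (hm p hp).le]
  have := hm p hp
  have : 0 < y ^ 2 := by positivity
  gcongr
  linarith

lemma doublePoleSum_conj (T : Finset ℝ) (m : ℝ → ℝ) (ρ : ℝ) (z : ℂ) :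
    doublePoleSum T m ρ ((starRingEnd ℂ) z) = (starRingEnd ℂ) (doublePoleSum T m ρ z) := by
  simp [doublePoleSum]

lemma tendsto_inv_sub_cobounded (b : ℂ) :
    Tendsto (fun z : ℂ => (z - b)⁻¹) (Bornology.cobounded ℂ) (𝓝 0) :=
  tendsto_inv₀_cobounded.comp (tendsto_sub_const_cobounded b)

lemma tendsto_sub_div_sub_cobounded (a b : ℂ) :
    Tendsto (fun z : ℂ => (z - a) / (z - b)) (Bornology.cobounded ℂ) (𝓝 1) := by
  have h : Tendsto (fun z : ℂ => 1 + (b - a) * (z - b)⁻¹) (Bornology.cobounded ℂ) (𝓝 1) := by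
    simpa using ((tendsto_inv_sub_cobounded b).const_mul (b - a)).const_add 1
  refine h.congr' ?_
  filter_upwards [Bornology.eventually_ne_cobounded b] with z hz
  have := sub_ne_zero.2 hz
  field_simp
  ring

lemma tendsto_doublePoleSum_cobounded (T : Finset ℝ) (m : ℝ → ℝ) (ρ : ℝ) :
    Tendsto (doublePoleSum T m ρ) (Bornology.cobounded ℂ) (𝓝 (-ρ)) := by
  have h (p : ℝ) : Tendsto (fun z : ℂ => (m p : ℂ) / (z - p) ^ 2) (Bornology.cobounded ℂ)
      (𝓝 0) := by
    simpa [div_eq_mul_inv] using ((tendsto_inv_sub_cobounded p).pow 2).const_mul (m p : ℂ)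
  unfold doublePoleSum
  simpa using (tendsto_finsetSum T fun p _ => h p).sub_const (ρ : ℂ)

/-- A function on the closed right half-plane which converges at infinity and has nonpositive
real part on the imaginary axis has nonpositive real part. -/
lemma re_nonpos_of_re_nonpos_imaginary_axis {h : ℂ → ℂ}
    (hd : ∀ z : ℂ, 0 ≤ z.re → DifferentiableAt ℂ h z) {l : ℂ}
    (hlim : Tendsto h (Bornology.cobounded ℂ) (𝓝 l))
    (him : ∀ y : ℝ, (h (y * I)).re ≤ 0) {z : ℂ} (hz : 0 ≤ z.re) : (h z).re ≤ 0 := by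
  have hexp : Tendsto (fun z => Complex.exp (h z)) (Bornology.cobounded ℂ) (𝓝 (Complex.exp l)) :=
    (Complex.continuous_exp.tendsto l).comp hlim
  have key : ‖Complex.exp (h z)‖ ≤ 1 := by
    refine PhragmenLindelof.right_half_plane_of_bounded_on_real
      (f := fun z => Complex.exp (h z)) ?_ ⟨1, by norm_num, 0, ?_⟩ ?_ ?_ hz
    · refine DifferentiableOn.diffContOnCl fun z hz => ?_
      rw [closure_setOfPred_lt_re] at hz
      exact (hd z hz).cexp.differentiableWithinAt
    · simpa using (hexp.isBigO_one ℝ).mono inf_le_left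
    · have : Tendsto (fun x : ℝ => (x : ℂ)) atTop (Bornology.cobounded ℂ) :=
        RCLike.tendsto_ofReal_atTop_cobounded ℂ
      exact (hexp.comp this).norm.isBoundedUnder_le
    · intro y
      rw [norm_exp]
      exact Real.exp_le_one_iff.2 (him y)
  rw [norm_exp] at key
  exact Real.exp_le_one_iff.1 key

/-- A function vanishing to first order cannot have nonpositive real part nearby. -/
lemma exists_re_pos_of_mul {k : ℂ → ℂ} {p : ℂ} (hk : ContinuousAt k p) (hkp : k p ≠ 0)
    (hp : 0 < p.re) : ∃ z : ℂ, 0 < z.re ∧ 0 < ((z - p) * k z).re := by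
  set v := (starRingEnd ℂ) (k p) with hv
  have hc : ContinuousAt (fun e : ℝ => p + e * v) 0 := by fun_prop
  have hk' : ContinuousAt (fun e : ℝ => (v * k (p + e * v)).re) 0 := by
    refine continuous_re.continuousAt.comp (continuousAt_const.mul ?_)
    exact ContinuousAt.comp (by simpa using hk) hc
  have h1 : ∀ᶠ e : ℝ in 𝓝 0, 0 < (v * k (p + e * v)).re := by
    refine hk'.eventually (lt_mem_nhds ?_)
    have : (v * k p).re = normSq (k p) := by
      rw [hv, mul_comm, mul_conj, ofReal_re]
    simpa [this] using hkp
  have h2 : ∀ᶠ e : ℝ in 𝓝 0, 0 < (p + e * v).re := by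
    refine (continuous_re.continuousAt.comp hc).eventually (lt_mem_nhds ?_)
    simpa using hp
  obtain ⟨e, ⟨h1, h2⟩, he⟩ :=
    (((h1.and h2).filter_mono nhdsWithin_le_nhds).and
      (eventually_mem_nhdsWithin (a := (0 : ℝ)) (s := Set.Ioi 0))).exists
  refine ⟨p + e * v, h2, ?_⟩
  rw [add_sub_cancel_left, mul_assoc, re_ofReal_mul]
  exact mul_pos he h1

/-- If `doublePoleSum` has a simple zero at `0` and exactly one zero, which is simple, in the open
right half-plane, then it has at most one pole there. -/
theorem doublePoleSum_pole_unique {T : Finset ℝ} {m : ℝ → ℝ} (hm : ∀ p ∈ T, 0 < m p)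
    {ρ : ℝ} (hρ : 0 < ρ) {a b : ℝ} (ha : a ∈ T) (hb : b ∈ T) (ha0 : 0 < a) (hb0 : 0 < b)
    (h0 : HasZeroOfOrder (doublePoleSum T m ρ) 0 1) {z₀ : ℂ} (hz₀ : 0 < z₀.re)
    (hz₀s : HasZeroOfOrder (doublePoleSum T m ρ) z₀ 1)
    (huniq : ∀ z : ℂ, 0 < z.re → (∀ p ∈ T, z ≠ (p : ℂ)) → doublePoleSum T m ρ z = 0 → z = z₀) :
    a = b := by
  by_contra hab
  obtain ⟨h0T, hs0, R₀, hR₀, hR₀0⟩ := h0.doublePoleNum_factor hm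
  obtain ⟨hz₀T, hsz₀, R₁, hR₁, hR₁0⟩ := hz₀s.doublePoleNum_factor hm
  obtain ⟨d, rfl⟩ : ∃ d : ℝ, z₀ = d := by
    refine (conj_eq_iff_real.1 (huniq _ (by simpa using hz₀) (fun p hp h => hz₀T p hp ?_) ?_))
    · simpa using congrArg (starRingEnd ℂ) h
    · rw [doublePoleSum_conj, hsz₀, map_zero]
  rw [ofReal_re] at hz₀
  rw [C_0, sub_zero] at hR₀
  have hdC : (d : ℂ) ≠ 0 := by exact_mod_cast hz₀.ne'
  obtain ⟨Q, hQ⟩ : (X - C (d : ℂ)) ∣ R₀ := by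
    refine dvd_iff_isRoot.2 ?_
    have : (X * R₀).eval (d : ℂ) = 0 := by rw [← hR₀, hR₁]; simp
    simpa [hdC] using this
  have hR₁' : R₁ = X * Q := by
    refine mul_left_cancel₀ (X_sub_C_ne_zero (d : ℂ)) ?_
    rw [← hR₁, hR₀, hQ]; ring
  have hnum : ∀ z : ℂ, (doublePoleNum T m ρ).eval z = z * (z - d) * Q.eval z := by
    intro z; rw [hR₀, hQ]; simp [mul_assoc]
  have hQne : ∀ z : ℂ, 0 ≤ z.re → Q.eval z ≠ 0 := by
    intro z hz hQz
    have hSz : (doublePoleNum T m ρ).eval z = 0 := by rw [hnum, hQz, mul_zero]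
    have hzT : ∀ p ∈ T, z ≠ (p : ℂ) := by
      rintro p hp rfl
      exact doublePoleNum_eval_ne_zero_of_mem hm ρ hp hSz
    have hsz : doublePoleSum T m ρ z = 0 := by
      rw [doublePoleNum_eval m ρ hzT] at hSz
      exact (mul_eq_zero.1 hSz).resolve_left (doublePoleDen_eval_ne_zero hzT)
    rcases hz.lt_or_eq with hz | hz
    · have := huniq z hz hzT hsz
      rw [hR₁', ← this] at hR₁0
      simp [hQz] at hR₁0
    · have hzy : z = (z.im : ℂ) * I := by apply Complex.ext <;> simp [← hz]
      by_cases hy : z.im = 0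
      · rw [hy, ofReal_zero, zero_mul] at hzy
        rw [hzy] at hQz
        exact hR₀0 (by rw [hQ, eval_mul, hQz, mul_zero])
      · have := doublePoleSum_re_neg ⟨a, ha⟩ hm h0T hs0 hy
        rw [← hzy, hsz] at this
        simp at this
  set N := doublePoleDen ((T.erase a).erase b) with hN
  have hb' : b ∈ T.erase a := Finset.mem_erase.2 ⟨Ne.symm hab, hb⟩
  have hden : ∀ z : ℂ, (doublePoleDen T).eval z = (z - a) ^ 2 * ((z - b) ^ 2 * N.eval z) :=
    fun z => by rw [doublePoleDen_eval_erase ha, doublePoleDen_eval_erase hb']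
  set k : ℂ → ℂ := fun z =>
    z * (z + d) * (z - b) * N.eval z / ((z + a) * (z + b) * Q.eval z) with hk
  have hpos : ∀ {c : ℝ}, 0 < c → ∀ {z : ℂ}, 0 ≤ z.re → z + c ≠ 0 := by
    intro c hc z hz h
    have := congrArg re h
    simp at this
    linarith
  have hkd : ∀ z : ℂ, 0 ≤ z.re → DifferentiableAt ℂ k z := by
    intro z hz
    refine DifferentiableAt.div (by fun_prop) (by fun_prop) ?_
    exact mul_ne_zero (mul_ne_zero (hpos ha0 hz) (hpos hb0 hz)) (hQne z hz)
  have hform : ∀ z : ℂ, z ≠ 0 → z ≠ d → (∀ p ∈ T, z ≠ (p : ℂ)) →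
      (z - a) * k z = ((z - 0) / (z - a)) * ((z - 0) / (z - (-a : ℂ))) * ((z - d) / (z - b)) *
        ((z - (-d : ℂ)) / (z - (-b : ℂ))) / doublePoleSum T m ρ z := by
    intro z hz hzd hzT
    have e := doublePoleNum_eval m ρ hzT
    have hD := doublePoleDen_eval_ne_zero hzT
    have hs : doublePoleSum T m ρ z
        = z * (z - d) * Q.eval z / ((z - a) ^ 2 * ((z - b) ^ 2 * N.eval z)) := by
      rw [← hden, ← hnum, e, mul_div_cancel_left₀ _ hD]
    rw [hden] at hD
    have hza : z - a ≠ 0 := sub_ne_zero.2 (hzT a ha)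
    have hzb : z - b ≠ 0 := sub_ne_zero.2 (hzT b hb)
    have hzd' : z - d ≠ 0 := sub_ne_zero.2 hzd
    rw [hs, hk]
    simp only [sub_zero, sub_neg_eq_add, div_eq_mul_inv, mul_inv, inv_inv]
    field_simp
  have hlim : Tendsto (fun z => (z - a) * k z) (Bornology.cobounded ℂ)
      (𝓝 (1 * 1 * 1 * 1 / (-ρ : ℂ))) := by
    refine Tendsto.congr' ?_ (((((tendsto_sub_div_sub_cobounded 0 a).mul
      (tendsto_sub_div_sub_cobounded 0 (-a))).mul (tendsto_sub_div_sub_cobounded d b)).mul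
      (tendsto_sub_div_sub_cobounded (-d) (-b))).div (tendsto_doublePoleSum_cobounded T m ρ)
      (neg_ne_zero.2 (by exact_mod_cast hρ.ne')))
    filter_upwards [Bornology.eventually_ne_cobounded (0 : ℂ), Bornology.eventually_ne_cobounded (d : ℂ),
      (Filter.eventually_all_finset T).2 fun p _ => Bornology.eventually_ne_cobounded (p : ℂ)]
      with z h1 h2 h3
    exact (hform z h1 h2 h3).symm
  have him : ∀ y : ℝ, ((y * I - a) * k (y * I)).re ≤ 0 := by
    intro y
    by_cases hy : y = 0
    · simp [hk, hy]
    have hre : ∀ {c : ℝ}, 0 < c → (y * I : ℂ) ≠ c := by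
      intro c hc h
      have := congrArg re h
      simp at this
      exact hc.ne this
    have hyT : ∀ p ∈ T, (y * I : ℂ) ≠ p := by
      intro p hp h
      have := congrArg im h
      simp at this
      exact hy this
    rw [hform _ (by simp [hy]) (hre hz₀) hyT]
    have hneg := doublePoleSum_re_neg ⟨a, ha⟩ hm h0T hs0 hy
    have hφ : (((y * I : ℂ) - 0) / (y * I - a)) * ((y * I - 0) / (y * I - (-a : ℂ))) *
        ((y * I - d) / (y * I - b)) * ((y * I - (-d : ℂ)) / (y * I - (-b : ℂ)))
        = ((y ^ 2 * (y ^ 2 + d ^ 2) / ((y ^ 2 + a ^ 2) * (y ^ 2 + b ^ 2)) : ℝ) : ℂ) := by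
      have e : ∀ c : ℝ, (y * I - c) * (y * I - (-c : ℂ)) = -((y ^ 2 + c ^ 2 : ℝ) : ℂ) := by
        intro c
        push_cast
        linear_combination (y : ℂ) ^ 2 * I_sq
      have e0 : (y * I - 0 : ℂ) * (y * I - 0) = -((y ^ 2 : ℝ) : ℂ) := by
        push_cast
        linear_combination (y : ℂ) ^ 2 * I_sq
      rw [div_mul_div_comm, mul_assoc, div_mul_div_comm, e0, e a, e d, e b, neg_div_neg_eq,
        neg_div_neg_eq]
      push_cast
      rw [div_mul_div_comm]
    rw [hφ, div_eq_mul_inv, re_ofReal_mul, inv_re]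
    refine mul_nonpos_of_nonneg_of_nonpos (by positivity) ?_
    exact div_nonpos_of_nonpos_of_nonneg hneg.le (normSq_nonneg _)
  have haC : (0 : ℝ) ≤ (a : ℂ).re := by simpa using ha0.le
  obtain ⟨z, hz, hzpos⟩ := exists_re_pos_of_mul (hkd a haC).continuousAt (p := (a : ℂ)) (by
    refine div_ne_zero (mul_ne_zero (mul_ne_zero (mul_ne_zero ?_ (hpos hz₀ haC)) ?_) ?_)
      (mul_ne_zero (mul_ne_zero (hpos ha0 haC) (hpos hb0 haC)) (hQne _ haC))
    · exact_mod_cast ha0.ne'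
    · exact sub_ne_zero.2 (by exact_mod_cast hab)
    · refine doublePoleDen_eval_ne_zero fun p hp h => ?_
      have : a = p := by exact_mod_cast h
      simp [this] at hp) (by simpa using ha0)
  exact absurd (re_nonpos_of_re_nonpos_imaginary_axis
    (fun z hz => DifferentiableAt.mul (by fun_prop) (hkd z hz)) hlim him hz.le) (not_le.2 hzpos)

/-- Translating the secular function gives a `doublePoleSum` over its distinct poles. -/
lemma secular_add_eq_doublePoleSum {n : ℕ} (lam : Fin n → ℝ) (w : Fin n → Fin n → ℝ)
    (q : Fin n → ℝ) (r μ : ℝ) (z : ℂ) :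
    secular lam w q r (z + μ) = doublePoleSum
      ((Finset.univ.filter fun i => w i ⬝ᵥ q ≠ 0).image fun i => -lam i - μ)
      (fun p => ∑ i ∈ (Finset.univ.filter fun i => w i ⬝ᵥ q ≠ 0) with -lam i - μ = p,
        (w i ⬝ᵥ q) ^ 2) (r ^ 2) z := by
  rw [secular, doublePoleSum, ofReal_pow]
  congr 1
  rw [← Finset.sum_subset (Finset.subset_univ (Finset.univ.filter fun i => w i ⬝ᵥ q ≠ 0)),
    ← Finset.sum_fiberwise_of_maps_to (fun i hi => Finset.mem_image_of_mem
      (fun i => -lam i - μ) hi)]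
  · refine Finset.sum_congr rfl fun p _ => ?_
    push_cast
    rw [Finset.sum_div]
    refine Finset.sum_congr rfl fun i hi => ?_
    rw [← (Finset.mem_filter.1 hi).2]
    push_cast
    ring
  · intro i _ hi
    simp only [Finset.mem_filter, Finset.mem_univ, true_and, not_not] at hi
    simp [hi]

lemma HasZeroOfOrder.comp_add_const {f : ℂ → ℂ} {z c : ℂ} {k : ℕ}
    (h : HasZeroOfOrder f (z + c) k) : HasZeroOfOrder (fun u => f (u + c)) z k := by
  obtain ⟨g, hg, hgz, hev⟩ := h
  refine ⟨fun u => g (u + c), hg.comp_of_eq (by fun_prop) rfl, hgz, ?_⟩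
  have : Tendsto (fun u : ℂ => u + c) (𝓝 z) (𝓝 (z + c)) := by
    exact (by fun_prop : Continuous fun u : ℂ => u + c).tendsto z
  filter_upwards [this.eventually hev] with u hu
  rw [hu, add_sub_add_right_eq_sub]

/-- if `w₁ᵀq ≠ 0`, `w₂ᵀq ≠ 0`, `λ₁ ≠ λ₂`, and `μ ∈ ℝ` is a simple root of `s`
that is the second-rightmost root of `s` in `ℂ` (exactly one root of `s`, counted with
multiplicity, has real part greater than `μ`), then `μ ≥ -λ₂`. -/
theorem stmt_8 {n : ℕ} (hn : 1 < n)
    (P : Matrix (Fin n) (Fin n) ℝ) (hP : P.IsSymm)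
    (lam : Fin n → ℝ) (w : Fin n → Fin n → ℝ)
    (hmono : Monotone lam)
    (heig : ∀ i, P.mulVec (w i) = lam i • w i)
    (horth : ∀ i j, w i ⬝ᵥ w j = if i = j then (1 : ℝ) else 0)
    (q : Fin n → ℝ) (r : ℝ) (hr : 0 < r)
    (μ : ℝ)
    (hc1 : w ⟨0, by omega⟩ ⬝ᵥ q ≠ 0)
    (hc2 : w ⟨1, hn⟩ ⬝ᵥ q ≠ 0)
    (hne : lam ⟨0, by omega⟩ ≠ lam ⟨1, hn⟩)
    (hsimple : HasZeroOfOrder (secular lam w q r) (μ : ℂ) 1)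
    (hsecond : ∃ z₀ : ℂ, (μ : ℝ) < z₀.re ∧
        IsNonpole lam w q z₀ ∧ secular lam w q r z₀ = 0 ∧
        HasZeroOfOrder (secular lam w q r) z₀ 1 ∧
        (∀ z : ℂ, (μ : ℝ) < z.re → IsNonpole lam w q z → secular lam w q r z = 0 → z = z₀)) :
    -(lam ⟨1, hn⟩) ≤ μ := by
  by_contra! hlt
  obtain ⟨z₀, hz₀, -, -, hz₀s, huniq⟩ := hsecond
  have hle : lam ⟨0, by omega⟩ ≤ lam ⟨1, hn⟩ := hmono (by simp [Fin.le_def])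
  have hfun := funext (secular_add_eq_doublePoleSum lam w q r μ)
  refine hne ?_
  suffices -lam ⟨0, by omega⟩ - μ = -lam ⟨1, hn⟩ - μ by linarith
  refine doublePoleSum_pole_unique (z₀ := z₀ - μ) ?_ (pow_pos hr 2)
    (Finset.mem_image_of_mem (fun i => -lam i - μ) (Finset.mem_filter.2 ⟨Finset.mem_univ _, hc1⟩))
    (Finset.mem_image_of_mem (fun i => -lam i - μ) (Finset.mem_filter.2 ⟨Finset.mem_univ _, hc2⟩))
    (by linarith) (by linarith) (hfun ▸ HasZeroOfOrder.comp_add_const (by simpa using hsimple))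
    (by simpa using hz₀) (hfun ▸ HasZeroOfOrder.comp_add_const (by simpa using hz₀s)) ?_
  · intro p hp
    obtain ⟨i, hi, rfl⟩ := Finset.mem_image.1 hp
    refine Finset.sum_pos (fun j hj => ?_) ⟨i, Finset.mem_filter.2 ⟨hi, rfl⟩⟩
    have := (Finset.mem_filter.1 (Finset.mem_filter.1 hj).1).2
    positivity
  · intro z hz hzT hs
    rw [← secular_add_eq_doublePoleSum] at hs
    refine eq_sub_of_add_eq (huniq _ (by simpa using hz) (fun i hi h => ?_) hs)
    refine hzT _ (Finset.mem_image_of_mem (fun i => -lam i - μ)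
      (Finset.mem_filter.2 ⟨Finset.mem_univ _, hi⟩)) ?_
    push_cast
    exact eq_sub_of_add_eq h
end

section
/- Problems (S) and (R) have the same optimal value, and every local minimizer w̄ = (w̄₁, w̄₂) of (R) yields a local minimizer x̄ = w̄₁ − w̄₂ of (S) with the same objective value. -/
open Matrix
open scoped Classical

noncomputable section

/-- The objective of problem (S): `f(x) = -xᵀΣx`. -/
def fobj {n : ℕ} (Sig : Matrix (Fin n) (Fin n) ℝ) (x : Fin n → ℝ) : ℝ :=
  -(x ⬝ᵥ Sig.mulVec x)

/-- The feasible set of problem (S): `‖x‖₂ ≤ 1` and `‖x‖₁ ≤ γ`. -/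
def feasS {n : ℕ} (γ : ℝ) (x : Fin n → ℝ) : Prop :=
  euclNorm x ≤ 1 ∧ (∑ i, |x i|) ≤ γ

/-- The objective of problem (R): `g(w) = -(w₁ - w₂)ᵀΣ(w₁ - w₂)`. -/
def gobj {n : ℕ} (Sig : Matrix (Fin n) (Fin n) ℝ) (w : (Fin n → ℝ) × (Fin n → ℝ)) : ℝ :=
  -((w.1 - w.2) ⬝ᵥ Sig.mulVec (w.1 - w.2))

/-- The feasible set of problem (R): `‖w‖₂ ≤ 1`, `𝟙ᵀw ≤ γ`, `w ≥ 0`. -/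
def feasR {n : ℕ} (γ : ℝ) (w : (Fin n → ℝ) × (Fin n → ℝ)) : Prop :=
  Real.sqrt (w.1 ⬝ᵥ w.1 + w.2 ⬝ᵥ w.2) ≤ 1 ∧
  ((∑ i, w.1 i) + (∑ i, w.2 i)) ≤ γ ∧
  (∀ i, 0 ≤ w.1 i) ∧ (∀ i, 0 ≤ w.2 i)

end

open Filter Topology

lemma feasS_iff {n : ℕ} {γ : ℝ} {x : Fin n → ℝ} :
    feasS γ x ↔ ∑ i, x i ^ 2 ≤ 1 ∧ ∑ i, |x i| ≤ γ := by
  simp only [feasS, euclNorm, dotProduct, Real.sqrt_le_iff, zero_le_one,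
    true_and, one_pow, ← sq]

lemma feasR_iff {n : ℕ} {γ : ℝ} {w : (Fin n → ℝ) × (Fin n → ℝ)} :
    feasR γ w ↔ ∑ i, (w.1 i ^ 2 + w.2 i ^ 2) ≤ 1 ∧ ∑ i, (w.1 i + w.2 i) ≤ γ ∧
      (∀ i, 0 ≤ w.1 i) ∧ ∀ i, 0 ≤ w.2 i := by
  simp only [feasR, dotProduct, Real.sqrt_le_iff, zero_le_one, true_and, one_pow, ← sq,
    Finset.sum_add_distrib]

lemma feasS_sub_of_feasR {n : ℕ} {γ : ℝ} {w : (Fin n → ℝ) × (Fin n → ℝ)} (hw : feasR γ w) :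
    feasS γ (w.1 - w.2) := by
  obtain ⟨h2, h1, hp, hq⟩ := feasR_iff.1 hw
  refine feasS_iff.2 ⟨(Finset.sum_le_sum fun i _ => ?_).trans h2,
    (Finset.sum_le_sum fun i _ => ?_).trans h1⟩
  · have := mul_nonneg (hp i) (hq i)
    simp only [Pi.sub_apply]
    nlinarith
  · have := hp i
    have := hq i
    simp only [Pi.sub_apply]
    exact abs_le.2 ⟨by linarith, by linarith⟩

/-- The positive and negative parts of `x`, both shifted by `c`. -/
def shiftedParts {n : ℕ} (c x : Fin n → ℝ) : (Fin n → ℝ) × (Fin n → ℝ) :=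
  (fun i => max (x i) 0 + c i, fun i => max (-x i) 0 + c i)

lemma shiftedParts_sub {n : ℕ} (c x : Fin n → ℝ) :
    (shiftedParts c x).1 - (shiftedParts c x).2 = x := by
  ext i
  simp only [shiftedParts, Pi.sub_apply]
  rcases le_total (x i) 0 with h | h
  · rw [max_eq_right h, max_eq_left (by linarith)]
    ring
  · rw [max_eq_left h, max_eq_right (by linarith)]
    ring

lemma shiftedParts_min {n : ℕ} (w : (Fin n → ℝ) × (Fin n → ℝ)) :
    shiftedParts (fun i => min (w.1 i) (w.2 i)) (w.1 - w.2) = w := by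
  refine Prod.ext (funext fun i => ?_) (funext fun i => ?_) <;>
    simp only [shiftedParts, Pi.sub_apply] <;>
    rcases le_total (w.1 i) (w.2 i) with h | h
  · rw [max_eq_right (by linarith), min_eq_left h]
    ring
  · rw [max_eq_left (by linarith), min_eq_right h]
    ring
  · rw [max_eq_left (by linarith), min_eq_left h]
    ring
  · rw [max_eq_right (by linarith), min_eq_right h]
    ring

lemma continuous_shiftedParts {n : ℕ} :
    Continuous fun p : (Fin n → ℝ) × (Fin n → ℝ) => shiftedParts p.1 p.2 := by
  unfold shiftedParts
  fun_prop

lemma feasR_shiftedParts_zero {n : ℕ} {γ : ℝ} {x : Fin n → ℝ} (hx : feasS γ x) :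
    feasR γ (shiftedParts 0 x) := by
  obtain ⟨h2, h1⟩ := feasS_iff.1 hx
  refine feasR_iff.2 ⟨(Finset.sum_le_sum fun i _ => ?_).trans h2,
    (Finset.sum_le_sum fun i _ => ?_).trans h1, fun i => ?_, fun i => ?_⟩
  · simp only [shiftedParts, Pi.zero_apply, add_zero]
    rcases le_total (x i) 0 with h | h
    · rw [max_eq_right h, max_eq_left (by linarith)]
      nlinarith
    · rw [max_eq_left h, max_eq_right (by linarith)]
      nlinarith
  · simp only [shiftedParts, Pi.zero_apply, add_zero]
    rcases le_total (x i) 0 with h | h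
    · rw [max_eq_right h, max_eq_left (by linarith), abs_of_nonpos h, zero_add]
    · rw [max_eq_left h, max_eq_right (by linarith), abs_of_nonneg h, add_zero]
  · simp [shiftedParts]
  · simp [shiftedParts]

/-- Shrinking a nonzero shift strictly decreases both norms, so that every point near
`x` keeps a feasible decomposition. -/
lemma eventually_feasR_shiftedParts {n : ℕ} {γ : ℝ} {m c x : Fin n → ℝ}
    (hfeas : feasR γ (shiftedParts m x)) (hc : ∀ i, 0 ≤ c i) (hcm : c < m) :
    ∀ᶠ y in 𝓝 x, feasR γ (shiftedParts c y) := by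
  obtain ⟨h2, h1, -, -⟩ := feasR_iff.1 hfeas
  obtain ⟨hle, j, hj⟩ := Pi.lt_def.1 hcm
  have hs2 : ∑ i, ((shiftedParts c x).1 i ^ 2 + (shiftedParts c x).2 i ^ 2) < 1 := by
    refine lt_of_lt_of_le (Finset.sum_lt_sum (fun i _ => ?_) ⟨j, Finset.mem_univ j, ?_⟩) h2
    · have := hc i
      have := hle i
      simp only [shiftedParts]
      gcongr
    · have := hc j
      simp only [shiftedParts]
      gcongr
  have hs1 : ∑ i, ((shiftedParts c x).1 i + (shiftedParts c x).2 i) < γ := by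
    refine lt_of_lt_of_le (Finset.sum_lt_sum (fun i _ => ?_) ⟨j, Finset.mem_univ j, ?_⟩) h1
    · have := hle i
      simp only [shiftedParts]
      gcongr
    · simp only [shiftedParts]
      gcongr
  have c2 : Continuous fun y : Fin n → ℝ =>
      ∑ i, ((shiftedParts c y).1 i ^ 2 + (shiftedParts c y).2 i ^ 2) := by
    unfold shiftedParts
    fun_prop
  have c1 : Continuous fun y : Fin n → ℝ =>
      ∑ i, ((shiftedParts c y).1 i + (shiftedParts c y).2 i) := by
    unfold shiftedParts
    fun_prop
  filter_upwards [c2.continuousAt.eventually_lt_const hs2,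
    c1.continuousAt.eventually_lt_const hs1] with y hy2 hy1
  exact feasR_iff.2 ⟨hy2.le, hy1.le, fun i => add_nonneg (le_max_right _ _) (hc i),
    fun i => add_nonneg (le_max_right _ _) (hc i)⟩

/-- Every feasible point of (S) near `w₁ - w₂` lifts to a feasible point of (R) near `w`. -/
lemma eventually_exists_feasR_sub_eq {n : ℕ} {γ : ℝ} {w : (Fin n → ℝ) × (Fin n → ℝ)}
    (hw : feasR γ w) {p : (Fin n → ℝ) × (Fin n → ℝ) → Prop} (hp : ∀ᶠ u in 𝓝 w, p u) :
    ∀ᶠ y in 𝓝[{x | feasS γ x}] (w.1 - w.2), ∃ u, feasR γ u ∧ p u ∧ u.1 - u.2 = y := by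
  set m : Fin n → ℝ := fun i => min (w.1 i) (w.2 i)
  have hwm : shiftedParts m (w.1 - w.2) = w := shiftedParts_min w
  have hm0 : 0 ≤ m := fun i => le_min (hw.2.2.1 i) (hw.2.2.2 i)
  have hev : ∀ᶠ q in 𝓝 (m, w.1 - w.2), p (shiftedParts q.1 q.2) :=
    continuous_shiftedParts.continuousAt.eventually (by simpa only [hwm] using hp)
  rw [nhds_prod_eq] at hev
  obtain hmz | hmpos := hm0.eq_or_lt
  · filter_upwards [self_mem_nhdsWithin, mem_nhdsWithin_of_mem_nhds hev.curry.self_of_nhds]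
      with y hy hpy
    rw [← hmz] at hpy
    exact ⟨_, feasR_shiftedParts_zero hy, hpy, shiftedParts_sub _ _⟩
  · have hcont : Tendsto (fun s : ℝ => s • m) (𝓝[<] 1) (𝓝 m) := by
      have : ContinuousAt (fun s : ℝ => s • m) 1 := by fun_prop
      simpa [ContinuousAt] using this.tendsto.mono_left (nhdsWithin_le_nhds (s := Set.Iio 1))
    obtain ⟨s, hs, hs0, hs1⟩ := ((hcont.eventually hev.curry).and
      (Ioo_mem_nhdsLT (zero_lt_one' ℝ))).exists
    have hlt : s • m < m := by
      obtain ⟨-, j, hj⟩ := Pi.lt_def.1 hmpos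
      refine Pi.lt_def.2 ⟨fun i => mul_le_of_le_one_left (hm0 i) hs1.le, j, ?_⟩
      exact mul_lt_of_lt_one_left hj hs1
    have hfe := eventually_feasR_shiftedParts (hwm.symm ▸ hw)
      (fun i => mul_nonneg hs0.le (hm0 i)) hlt
    filter_upwards [mem_nhdsWithin_of_mem_nhds hs, mem_nhdsWithin_of_mem_nhds hfe]
      with y hpy hy
    exact ⟨_, hy, hpy, shiftedParts_sub _ _⟩

/-- problems (S) and (R) have the same optimal value, and every local
minimizer `w̄ = (w̄₁, w̄₂)` of (R) yields a local minimizer `x̄ = w̄₁ - w̄₂` of (S) with the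
same objective value. -/
theorem stmt_16 {n : ℕ}
    (Sig : Matrix (Fin n) (Fin n) ℝ) (hsymm : Sig.IsSymm)
    (hpsd : ∀ x : Fin n → ℝ, 0 ≤ x ⬝ᵥ Sig.mulVec x)
    (γ : ℝ) (hγ : 1 ≤ γ) :
    sInf {v : ℝ | ∃ x : Fin n → ℝ, feasS γ x ∧ v = fobj Sig x}
        = sInf {v : ℝ | ∃ w : (Fin n → ℝ) × (Fin n → ℝ), feasR γ w ∧ v = gobj Sig w}
    ∧ (∀ w : (Fin n → ℝ) × (Fin n → ℝ), feasR γ w →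
        IsLocalMinOn (gobj Sig) {u | feasR γ u} w →
        (feasS γ (w.1 - w.2) ∧
          IsLocalMinOn (fobj Sig) {x | feasS γ x} (w.1 - w.2) ∧
          fobj Sig (w.1 - w.2) = gobj Sig w)) := by
  refine ⟨congrArg sInf (Set.ext fun v => ⟨?_, ?_⟩), fun w hw hmin => ?_⟩
  · rintro ⟨x, hx, rfl⟩
    exact ⟨shiftedParts 0 x, feasR_shiftedParts_zero hx, by rw [gobj, shiftedParts_sub, fobj]⟩
  · rintro ⟨w, hw, rfl⟩
    exact ⟨w.1 - w.2, feasS_sub_of_feasR hw, rfl⟩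
  · refine ⟨feasS_sub_of_feasR hw, ?_, rfl⟩
    filter_upwards [eventually_exists_feasR_sub_eq hw (eventually_nhdsWithin_iff.1 hmin)]
    rintro _ ⟨u, hu, hle, rfl⟩
    exact hle hu
end
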